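/- arXiv:2506.02984 — 3 statements merged into one kernel-verified Lean document; each statement's English description precedes it below -/
import Mathlib

section
/- For every n ≥ 1, each of the three pairs (M_0, M_1), (M_0, M_1F), (M_0F, M_1) is topologically contractive: for every sequence a ∈ {0,1}^ℕ, the intersection over t ≥ 0 of the sets (A_{a_0} A_{a_1} ⋯ A_{a_{t−1}})[Δ] is a singleton, where (A_0, A_1) is any one of these three pairs. -/
open Matrix

abbrev MatZ (n : ℕ) : Type := Matrix (Fin (n + 1)) (Fin (n + 1)) ℤ

def inSigma {n : ℕ} (A : MatZ n) : Prop :=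
  IsUnit A.det ∧ ∀ i j, 0 ≤ A i j

def IsPermMat {n : ℕ} (A : MatZ n) : Prop :=
  ∃ σ : Equiv.Perm (Fin (n + 1)), ∀ i j, A i j = if i = σ j then 1 else 0

noncomputable def toR {n : ℕ} (A : MatZ n) : Matrix (Fin (n + 1)) (Fin (n + 1)) ℝ :=
  A.map ((↑) : ℤ → ℝ)

noncomputable def projAct {n : ℕ} (A : Matrix (Fin (n + 1)) (Fin (n + 1)) ℝ)
    (x : Fin (n + 1) → ℝ) : Fin (n + 1) → ℝ :=
  (∑ i, (A *ᵥ x) i)⁻¹ • (A *ᵥ x)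

noncomputable def simg {n : ℕ} (A : MatZ n) : Set (Fin (n + 1) → ℝ) :=
  projAct (toR A) '' stdSimplex ℝ (Fin (n + 1))

def wordProd {n : ℕ} (A0 A1 : MatZ n) (w : List Bool) : MatZ n :=
  (w.map (fun b => bif b then A1 else A0)).prod

def Contractive {n : ℕ} (A0 A1 : MatZ n) : Prop :=
  ∀ a : ℕ → Bool, ∃ p,
    (⋂ t : ℕ, simg (wordProd A0 A1 ((List.range t).map a))) = {p}

def Nmat (n : ℕ) : MatZ n :=
  Matrix.of fun i j => if i = j then 1 else if j = 1 ∧ i = 0 then 1 else 0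

def Fmat (n : ℕ) : MatZ n :=
  Matrix.of fun i j => if i = Equiv.swap (0 : Fin (n + 1)) 1 j then 1 else 0

def Rmat (n : ℕ) : MatZ n :=
  Matrix.of fun i j => if i = j + 1 then 1 else 0

def Lmat (n : ℕ) : MatZ n := Fmat n * Nmat n * Fmat n

def Mon0 (n : ℕ) : MatZ n := Nmat n * Fmat n * Rmat n

def Mon1 (n : ℕ) : MatZ n := Lmat n * Rmat n

def permMat {n : ℕ} (σ : Equiv.Perm (Fin (n + 1))) : MatZ n :=
  Matrix.of fun i j => if i = σ j then 1 else 0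


namespace Mk

def Rec {α : Type*} (op : α → α → α) (n : ℕ) (sw : ℕ → Bool) (x q : ℕ → α) : Prop :=
  (∀ t, x (t + 1) = if sw t then q t else x t) ∧ ∀ t, q (t + n) = op (x t) (q t)

def Al {α : Type*} (n : ℕ) (x q : ℕ → α) (t : ℕ) (p : α → Prop) : Prop :=
  p (x t) ∧ ∀ i < n, p (q (t + i))

lemma Al.mono {α : Type*} {n : ℕ} {x q : ℕ → α} {t : ℕ} {p p' : α → Prop}
    (h : Al n x q t p) (hp : ∀ a, p a → p' a) : Al n x q t p' :=
  ⟨hp _ h.1, fun i hi => hp _ (h.2 i hi)⟩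

lemma Al.step' {α : Type*} {op : α → α → α} {n : ℕ} {sw : ℕ → Bool} {x q : ℕ → α}
    (hR : Rec op n sw x q) (hn : 1 ≤ n) {p p' : α → Prop} {t : ℕ} (h : Al n x q t p)
    (hop : ∀ a b, p a → p b → p' (op a b)) (hp : ∀ a, p a → p' a) :
    Al n x q (t + 1) p' := by
  refine ⟨?_, fun i hi => ?_⟩
  · rw [hR.1 t]
    split
    · exact hp _ (by simpa using h.2 0 (by omega))
    · exact hp _ h.1
  · by_cases hi' : i + 1 < n
    · have := h.2 (i + 1) hi'
      rw [show t + 1 + i = t + (i + 1) by ring]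
      exact hp _ this
    · rw [show t + 1 + i = t + n by omega, hR.2 t]
      exact hop _ _ h.1 (by simpa using h.2 0 (by omega))

lemma Al.step {α : Type*} {op : α → α → α} {n : ℕ} {sw : ℕ → Bool} {x q : ℕ → α}
    (hR : Rec op n sw x q) (hn : 1 ≤ n) {p : α → Prop} {t : ℕ} (h : Al n x q t p)
    (hop : ∀ a b, p a → p b → p (op a b)) (s : ℕ) (hs : t ≤ s) :
    Al n x q s p := by
  induction s, hs using Nat.le_induction with
  | base => exact h
  | succ s hs ih => exact ih.step' hR hn hop (fun _ => id)

lemma Rec.shift {α : Type*} {op : α → α → α} {n : ℕ} {sw : ℕ → Bool} {x q : ℕ → α}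
    (hR : Rec op n sw x q) (T : ℕ) :
    Rec op n (fun t => sw (T + t)) (fun t => x (T + t)) (fun t => q (T + t)) :=
  ⟨fun t => hR.1 (T + t), fun t => by simp only [← add_assoc]; exact hR.2 (T + t)⟩

lemma Rec.map {α β : Type*} {op : α → α → α} {op' : β → β → β} {n : ℕ} {sw : ℕ → Bool}
    {x q : ℕ → α} (hR : Rec op n sw x q) (f : α → β)
    (hf : ∀ a b, f (op a b) = op' (f a) (f b)) :
    Rec op' n sw (fun t => f (x t)) (fun t => f (q t)) :=
  ⟨fun t => by simp only [hR.1 t]; split <;> rfl, fun t => by simp only [hR.2 t, hf]⟩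

lemma Rec.prod {α β : Type*} {op : α → α → α} {op' : β → β → β} {n : ℕ} {sw : ℕ → Bool}
    {x q : ℕ → α} {x' q' : ℕ → β} (hR : Rec op n sw x q) (hR' : Rec op' n sw x' q') :
    Rec (fun a b => (op a.1 b.1, op' a.2 b.2)) n sw (fun t => (x t, x' t))
      (fun t => (q t, q' t)) :=
  ⟨fun t => by simp only [hR.1 t, hR'.1 t]; split <;> rfl,
    fun t => by simp only [hR.2 t, hR'.2 t]⟩

lemma rec_of_state {α : Type*} {op : α → α → α} {n : ℕ} (hn : 1 ≤ n) {sw : ℕ → Bool}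
    (X : ℕ → α) (Y : ℕ → ℕ → α) (h1 : ∀ t, X (t + 1) = if sw t then Y t 0 else X t)
    (h2 : ∀ t i, i + 1 < n → Y (t + 1) i = Y t (i + 1))
    (h3 : ∀ t, Y (t + 1) (n - 1) = op (X t) (Y t 0)) :
    Rec op n sw X (fun t => Y t 0) ∧ ∀ i < n, ∀ t, Y t i = Y (t + i) 0 := by
  have key : ∀ i < n, ∀ t, Y t i = Y (t + i) 0 := by
    intro i
    induction i with
    | zero => intro _ t; rfl
    | succ i ih =>
      intro hi t
      rw [← h2 t i hi, ih (by omega) (t + 1)]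
      congr 1; ring
  refine ⟨⟨h1, fun t => ?_⟩, key⟩
  have := key (n - 1) (by omega) (t + 1)
  rw [h3, show t + 1 + (n - 1) = t + n by omega] at this
  exact this.symm

lemma exists_rec {α : Type*} (op : α → α → α) {n : ℕ} (hn : 1 ≤ n) (sw : ℕ → Bool)
    (x0 : α) (q0 : ℕ → α) :
    ∃ x q, Rec op n sw x q ∧ x 0 = x0 ∧ ∀ i < n, q i = q0 i := by
  let st : ℕ → α × (ℕ → α) := fun t => Nat.rec (x0, q0) (fun t s =>
    (if sw t then s.2 0 else s.1,
      fun i => if i + 1 < n then s.2 (i + 1) else op s.1 (s.2 0))) t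
  have hst : ∀ t, st (t + 1) = (if sw t then (st t).2 0 else (st t).1,
      fun i => if i + 1 < n then (st t).2 (i + 1) else op (st t).1 ((st t).2 0)) :=
    fun t => rfl
  obtain ⟨h, h'⟩ := rec_of_state (op := op) hn (sw := sw) (fun t => (st t).1)
    (fun t => (st t).2)
    (fun t => by simp only [hst]) (fun t i hi => by simp only [hst, if_pos hi])
    (fun t => by simp only [hst]; rw [if_neg (by omega)])
  refine ⟨_, _, h, rfl, fun i hi => ?_⟩
  have := h' i hi 0
  simp only [zero_add] at this
  exact this.symm

/-! labels -/

def comb (a b : SignType) : SignType := if a = b then a else 0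

def cnt (n : ℕ) {α : Type*} (x q : ℕ → α) (f : α → ℕ) (t : ℕ) : ℕ :=
  f (x t) + ∑ i ∈ Finset.range n, f (q (t + i))

lemma sum_shift {M : Type*} [AddCommMonoid M] (n : ℕ) (f : ℕ → M) (t : ℕ) :
    f t + ∑ i ∈ Finset.range n, f (t + 1 + i) = (∑ i ∈ Finset.range n, f (t + i)) + f (t + n) := by
  rw [← Finset.sum_range_succ (fun i => f (t + i)), Finset.sum_range_succ']
  rw [add_comm]
  congr 1
  apply Finset.sum_congr rfl
  intro i _
  congr 1; ring

lemma label_good {n : ℕ} (hn : 1 ≤ n) {sw : ℕ → Bool} {x q : ℕ → SignType}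
    (hR : Rec comb n sw x q) :
    ∃ c : SignType, c ≠ 0 ∧ Al n x q (2 * n * (n + 2)) (fun l => l ≠ c) := by
  set N : ℕ → ℕ := cnt n x q (fun l => if l = 0 then 0 else 1) with hN
  have hstep : ∀ t, N (t + 1) + ((if x t = 0 then 0 else 1) + (if q t = 0 then 0 else 1)) =
      N t + ((if x (t+1) = 0 then 0 else 1) + (if comb (x t) (q t) = 0 then 0 else 1)) := by
    intro t
    have := sum_shift n (fun i => if q i = 0 then 0 else 1) t
    rw [hR.2 t] at this
    simp only [hN, cnt]
    omega
  have hcase : ∀ t, N (t + 1) ≤ N t ∧ (N (t + 1) = N t →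
      (x t ≠ 0 → x (t + 1) = x t ∧ (q t = 0 ∨ q t = x t)) ∧
      (x t = 0 → q t ≠ 0 → x (t + 1) ≠ 0)) := by
    intro t
    have h := hstep t
    have h1 := hR.1 t
    revert h h1
    generalize x t = a
    generalize q t = b
    generalize x (t + 1) = c
    generalize N (t + 1) = u
    generalize N t = v
    cases sw t <;> rcases a with _ | _ | _ <;> rcases b with _ | _ | _ <;>
      intro h h1 <;> subst h1 <;> simp [comb] at h ⊢ <;> omega
  have hanti : Antitone N := antitone_nat_of_succ_le (fun t => (hcase t).1)
  have main : ∀ k t, N t ≤ k → ∃ s ≤ t + 2 * n * (k + 1), ∃ c : SignType, c ≠ 0 ∧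
      Al n x q s (fun l => l ≠ c) := by
    intro k
    induction k with
    | zero =>
      intro t ht
      refine ⟨t, by omega, 1, by decide, ?_⟩
      simp [hN, cnt] at ht
      refine ⟨by rw [ht.1]; decide, fun i hi => by rw [ht.2 i hi]; decide⟩
    | succ k ih =>
      intro t ht
      by_cases hlt : N (t + 2 * n) < N t
      · obtain ⟨s, hs, h⟩ := ih (t + 2 * n) (by omega)
        exact ⟨s, by nlinarith, h⟩
      · have hc : ∀ s, t ≤ s → s < t + 2 * n → N (s + 1) = N s := by
          intro s h1 h2
          have a1 := hanti h1
          have a2 := hanti (show s + 1 ≤ t + 2 * n by omega)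
          have a3 := hanti (Nat.le_succ s)
          simp only [Nat.succ_eq_add_one] at a3
          omega
        by_cases hex : ∃ s, t ≤ s ∧ s ≤ t + n ∧ x s ≠ 0
        · obtain ⟨s, h1, h2, h3⟩ := hex
          have hx : ∀ i ≤ n, x (s + i) = x s := by
            intro i
            induction i with
            | zero => intro _; rfl
            | succ i ih =>
              intro hi
              have h := ih (by omega)
              have := ((hcase (s + i)).2 (hc _ (by omega) (by omega))).1 (by rwa [h])
              rw [← h]; exact this.1
          have hq : ∀ i < n, q (s + i) = 0 ∨ q (s + i) = x s := by
            intro i hi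
            have h := hx i (by omega)
            have := ((hcase (s + i)).2 (hc _ (by omega) (by omega))).1 (by rwa [h])
            rw [← h]; exact this.2
          refine ⟨s, by nlinarith, -x s, ?_, ?_, ?_⟩
          · revert h3; generalize x s = a; revert a; decide
          · revert h3; generalize x s = a; revert a; decide
          · intro i hi
            have := hq i hi
            revert this h3
            generalize x s = a
            generalize q (s + i) = b
            revert a b; decide
        · push Not at hex
          refine ⟨t, by omega, 1, by decide, ?_, ?_⟩
          · rw [hex t le_rfl (by omega)]; decide
          · intro i hi
            have h0 := hex (t + i) (by omega) (by omega)
            have h1 := hex (t + i + 1) (by omega) (by omega)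
            have := ((hcase (t + i)).2 (hc _ (by omega) (by omega))).2 h0
            have h2 : q (t + i) = 0 := by
              by_contra h; exact this h h1
            rw [h2]; decide
  have hN0 : N 0 ≤ n + 1 := by
    simp only [hN, cnt]
    have : ∑ i ∈ Finset.range n, (if q (0 + i) = 0 then 0 else 1) ≤ ∑ i ∈ Finset.range n, 1 :=
      Finset.sum_le_sum (fun i _ => by split <;> omega)
    simp only [Finset.sum_const, Finset.card_range, smul_eq_mul, mul_one] at this
    have : (if x 0 = 0 then 0 else 1) ≤ 1 := by split <;> omega
    omega
  obtain ⟨s, hs, c, hc0, hc⟩ := main (n + 1) 0 hN0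
  refine ⟨c, hc0, hc.step hR hn ?_ _ (by simpa using hs)⟩
  intro a b ha hb
  unfold comb
  split
  · exact ha
  · exact hc0.symm

lemma contract {n : ℕ} (hn : 1 ≤ n) (C : ℝ) (hC : 1 ≤ C) :
    ∃ η : ℝ, 0 < η ∧ η < 1 ∧ ∀ (sw : ℕ → Bool) (x q : ℕ → ℝ × ℝ),
      Rec (fun a b => a + b) n sw x q → ∀ m : ℝ, 0 < m →
      Al n x q 0 (fun v => (m ≤ v.2 ∧ v.2 ≤ C * m) ∧ 0 ≤ v.1 ∧ v.1 ≤ v.2) →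
      Al n x q (2 * n * (n + 2)) (fun v => v.1 ≤ (1 - η) * v.2) ∨
      Al n x q (2 * n * (n + 2)) (fun v => η * v.2 ≤ v.1) := by
  set L := 2 * n * (n + 2) with hL
  set κ : ℝ := 1 / (1 + 2 ^ L * C) with hκ
  have hden : 1 ≤ (2:ℝ) ^ L * C := by
    have : (1:ℝ) ≤ 2 ^ L := one_le_pow₀ (by norm_num)
    nlinarith
  have hκ0 : 0 < κ := by positivity
  have hκ1 : κ ≤ 1 := by
    rw [hκ, div_le_one (by linarith)]; linarith
  refine ⟨κ ^ L / 2, by positivity, ?_, ?_⟩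
  · have : κ ^ L ≤ 1 := pow_le_one₀ hκ0.le hκ1
    linarith
  intro sw x q hR m hm h0
  let lab : ℝ × ℝ → SignType := fun v => if v.1 ≤ v.2 / 2 then -1 else 1
  obtain ⟨lx, lq, hl, hl0, hlq⟩ := exists_rec comb hn sw (lab (x 0)) (fun i => lab (q i))
  have hR3 := hR.prod hl
  let P : ℕ → (ℝ × ℝ) × SignType → Prop := fun s v =>
    (m ≤ v.1.2 ∧ v.1.2 ≤ 2 ^ s * C * m) ∧ (0 ≤ v.1.1 ∧ v.1.1 ≤ v.1.2) ∧
    (v.2 ≠ 1 → v.1.1 ≤ (1 - κ ^ s / 2) * v.1.2) ∧ (v.2 ≠ -1 → κ ^ s / 2 * v.1.2 ≤ v.1.1)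
  have hlab : ∀ v : ℝ × ℝ, ((m ≤ v.2 ∧ v.2 ≤ C * m) ∧ 0 ≤ v.1 ∧ v.1 ≤ v.2) →
      P 0 (v, lab v) := by
    rintro ⟨g, w⟩ ⟨⟨h1, h2⟩, h3, h4⟩
    simp only at h1 h2 h3 h4
    refine ⟨⟨h1, by simpa using h2⟩, ⟨h3, h4⟩, ?_, ?_⟩
    · simp only [lab]
      split
      · intro _; simp only [pow_zero]; linarith
      · intro h; exact absurd rfl h
    · simp only [lab]
      split
      · intro h; exact absurd rfl h
      · intro _; simp only [pow_zero]; linarith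
  have hP : ∀ s ≤ L, Al n (fun t => (x t, lx t)) (fun t => (q t, lq t)) s (P s) := by
    intro s
    induction s with
    | zero =>
      intro _
      refine ⟨?_, fun i hi => ?_⟩
      · simp only [hl0]; exact hlab _ h0.1
      · simp only [zero_add, hlq i hi]
        have := h0.2 i hi
        rw [zero_add] at this
        exact hlab _ this
    | succ s ih =>
      intro hs
      have hpow : (2:ℝ) ^ s ≤ 2 ^ L := pow_le_pow_right₀ (by norm_num) (by omega)
      have hks : 0 < κ ^ s := by positivity
      have hks' : κ ^ (s + 1) ≤ κ ^ s := pow_le_pow_of_le_one hκ0.le hκ1 (by omega)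
      have hw : ∀ w w' : ℝ, m ≤ w → w' ≤ 2 ^ s * C * m → κ * (w + w') ≤ w := by
        intro w w' h1 h2
        rw [hκ, div_mul_eq_mul_div, one_mul, div_le_iff₀ (by linarith)]
        have : 2 ^ s * C * m ≤ 2 ^ L * C * w := by
          have h3 : (2:ℝ) ^ s * C ≤ 2 ^ L * C := mul_le_mul_of_nonneg_right hpow (by linarith)
          exact mul_le_mul h3 h1 hm.le (by positivity)
        linarith
      refine (ih (by omega)).step' hR3 hn ?_ ?_
      · rintro ⟨⟨g, w⟩, l⟩ ⟨⟨g', w'⟩, l'⟩ ⟨⟨a1, a2⟩, ⟨a3, a4⟩, a5, a6⟩ ⟨⟨b1, b2⟩, ⟨b3, b4⟩, b5, b6⟩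
        simp only at a1 a2 a3 a4 a5 a6 b1 b2 b3 b4 b5 b6
        have e1 := hw w w' a1 b2
        have e2 := hw w' w b1 a2
        have f1 : κ ^ s * (κ * (w + w')) ≤ κ ^ s * w := mul_le_mul_of_nonneg_left e1 hks.le
        have f2 : κ ^ s * (κ * (w' + w)) ≤ κ ^ s * w' := mul_le_mul_of_nonneg_left e2 hks.le
        refine ⟨⟨?_, ?_⟩, ⟨?_, ?_⟩, ?_, ?_⟩
        · change m ≤ w + w'; linarith
        · change w + w' ≤ 2 ^ (s + 1) * C * m
          rw [pow_succ]; linarith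
        · change 0 ≤ g + g'; linarith
        · change g + g' ≤ w + w'; linarith
        · change comb l l' ≠ 1 → g + g' ≤ (1 - κ ^ (s + 1) / 2) * (w + w')
          intro hc
          have : l ≠ 1 ∨ l' ≠ 1 := by
            by_contra hh; push Not at hh; apply hc; rw [hh.1, hh.2]; rfl
          rw [pow_succ]
          rcases this with h | h
          · have := a5 h; nlinarith
          · have := b5 h; nlinarith
        · change comb l l' ≠ -1 → κ ^ (s + 1) / 2 * (w + w') ≤ g + g'
          intro hc
          have : l ≠ -1 ∨ l' ≠ -1 := by
            by_contra hh; push Not at hh; apply hc; rw [hh.1, hh.2]; rfl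
          rw [pow_succ]
          rcases this with h | h
          · have := a6 h; nlinarith
          · have := b6 h; nlinarith
      · rintro ⟨⟨g, w⟩, l⟩ ⟨⟨a1, a2⟩, ⟨a3, a4⟩, a5, a6⟩
        simp only at a1 a2 a3 a4 a5 a6
        have hwp : 0 ≤ w := by linarith
        refine ⟨⟨a1, ?_⟩, ⟨a3, a4⟩, fun h => ?_, fun h => ?_⟩
        · change w ≤ 2 ^ (s + 1) * C * m
          rw [pow_succ]; linarith
        · have := a5 h
          change g ≤ (1 - κ ^ (s + 1) / 2) * w
          nlinarith
        · have := a6 h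
          change κ ^ (s + 1) / 2 * w ≤ g
          nlinarith
  obtain ⟨c, hc0, hc⟩ := label_good hn hl
  have hPL := hP L le_rfl
  have : c = 1 ∨ c = -1 := (by decide : ∀ c : SignType, c ≠ 0 → c = 1 ∨ c = -1) c hc0
  rcases this with rfl | rfl
  · left
    exact ⟨hPL.1.2.2.1 hc.1, fun i hi => (hPL.2 i hi).2.2.1 (hc.2 i hi)⟩
  · right
    exact ⟨hPL.1.2.2.2 hc.1, fun i hi => (hPL.2 i hi).2.2.2 (hc.2 i hi)⟩

def Osc (n : ℕ) (x q : ℕ → ℝ × ℝ) (t : ℕ) (δ : ℝ) : Prop :=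
  ∃ α : ℝ, Al n x q t (fun v => α * v.2 ≤ v.1 ∧ v.1 ≤ (α + δ) * v.2)

lemma Osc.step {n : ℕ} (hn : 1 ≤ n) {sw : ℕ → Bool} {x q : ℕ → ℝ × ℝ}
    (hR : Rec (fun a b => a + b) n sw x q) {t : ℕ} {δ : ℝ} (h : Osc n x q t δ) (s : ℕ)
    (hs : t ≤ s) : Osc n x q s δ := by
  obtain ⟨α, h⟩ := h
  refine ⟨α, h.step hR hn ?_ s hs⟩
  rintro ⟨g, w⟩ ⟨g', w'⟩ ⟨h1, h2⟩ ⟨h3, h4⟩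
  simp only [Prod.mk_add_mk] at *
  constructor <;> linarith

lemma contract' {n : ℕ} (hn : 1 ≤ n) (C : ℝ) (hC : 1 ≤ C) :
    ∃ η : ℝ, 0 < η ∧ η < 1 ∧ ∀ (sw : ℕ → Bool) (x q : ℕ → ℝ × ℝ),
      Rec (fun a b => a + b) n sw x q → ∀ (m : ℝ) (T : ℕ), 0 < m →
      Al n x q T (fun v => m ≤ v.2 ∧ v.2 ≤ C * m) → ∀ δ, 0 < δ → Osc n x q T δ →
      Osc n x q (T + 2 * n * (n + 2)) ((1 - η) * δ) := by
  obtain ⟨η, h0, h1, H⟩ := contract hn C hC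
  refine ⟨η, h0, h1, fun sw x q hR m T hm hA δ hδ ⟨α, hO⟩ => ?_⟩
  have hR' := (hR.shift T).map (op' := fun a b => a + b)
    (fun v : ℝ × ℝ => ((v.1 - α * v.2, δ * v.2) : ℝ × ℝ)) (by
      rintro ⟨g, w⟩ ⟨g', w'⟩
      simp only [Prod.mk_add_mk, Prod.mk.injEq]
      constructor <;> ring)
  have hh : ∀ v : ℝ × ℝ, (m ≤ v.2 ∧ v.2 ≤ C * m) → (α * v.2 ≤ v.1 ∧ v.1 ≤ (α + δ) * v.2) →
      (δ * m ≤ δ * v.2 ∧ δ * v.2 ≤ C * (δ * m)) ∧ 0 ≤ v.1 - α * v.2 ∧ v.1 - α * v.2 ≤ δ * v.2 := by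
    rintro ⟨g, w⟩ ⟨h1, h2⟩ ⟨h3, h4⟩
    simp only at *
    have := mul_le_mul_of_nonneg_left h1 hδ.le
    have := mul_le_mul_of_nonneg_left h2 hδ.le
    refine ⟨⟨by linarith, by linarith⟩, by linarith, by linarith⟩
  have := H _ _ _ hR' (δ * m) (by positivity)
    ⟨hh _ hA.1 hO.1, fun i hi => by
      have := hh _ (hA.2 i hi) (hO.2 i hi)
      simpa using this⟩
  have hO' := hO.step hR hn (by
    rintro ⟨g, w⟩ ⟨g', w'⟩ ⟨h1, h2⟩ ⟨h3, h4⟩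
    simp only [Prod.mk_add_mk] at *
    constructor <;> linarith) (T + 2 * n * (n + 2)) (by omega)
  rcases this with h | h
  · refine ⟨α, ⟨hO'.1.1, ?_⟩, fun i hi => ⟨(hO'.2 i hi).1, ?_⟩⟩
    · have := h.1
      simp only at this
      linarith
    · have := h.2 i hi
      simp only [← add_assoc] at this
      linarith
  · refine ⟨α + η * δ, ⟨?_, ?_⟩, fun i hi => ⟨?_, ?_⟩⟩
    · have := h.1
      simp only at this
      linarith
    · have := hO'.1.2
      linarith
    · have := h.2 i hi
      simp only [← add_assoc] at this
      linarith
    · have := (hO'.2 i hi).2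
      linarith

lemma ge_one {n : ℕ} (hn : 1 ≤ n) {sw : ℕ → Bool} {x q : ℕ → ℝ}
    (hR : Rec (fun a b => a + b) n sw x q) (h0 : Al n x q 0 (fun v => v = 1)) (t : ℕ) :
    Al n x q t (fun v => 1 ≤ v) :=
  (h0.mono (fun _ h => h.ge)).step hR hn (fun a b ha hb => by linarith) t (by omega)

noncomputable def bd (n : ℕ) : ℝ := ((n:ℝ) + 2) ^ ((n + 2) * (n + 1) + n) * (1 + n * (n + 1) + n)

lemma weight_bound {n : ℕ} (hn : 1 ≤ n) {sw : ℕ → Bool} {x q : ℕ → ℝ}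
    (hR : Rec (fun a b => a + b) n sw x q) (h0 : Al n x q 0 (fun v => v = 1))
    (θ : ℝ) (hθ : 1 ≤ θ) (t : ℕ) (ht : ∀ s ≤ t, ∃ b, s ≤ b ∧ b < s + n ∧ q b < θ) :
    Al n x q t (fun v => v ≤ bd n * θ) := by
  have h1 := ge_one hn hR h0
  have hx1 : ∀ t, 1 ≤ x t := fun t => (h1 t).1
  have hq1 : ∀ t, 1 ≤ q t := fun t => by simpa using (h1 t).2 0 (by omega)
  have hnr : (1:ℝ) ≤ n := by exact_mod_cast hn
  set S : ℕ → ℝ := fun t => min (x t) θ + ∑ i ∈ Finset.range n, min (q (t + i)) θ with hS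
  set d : ℕ → ℕ := cnt n x q (fun v => if v < θ then 1 else 0) with hd
  have hSle : ∀ t, S t ≤ (n + 1) * θ := by
    intro t
    have : ∑ i ∈ Finset.range n, min (q (t + i)) θ ≤ ∑ i ∈ Finset.range n, θ :=
      Finset.sum_le_sum (fun i _ => min_le_right _ _)
    simp only [Finset.sum_const, Finset.card_range, nsmul_eq_mul] at this
    have h2 : min (x t) θ ≤ θ := min_le_right _ _
    simp only [hS]
    linarith
  have hS0 : ∀ t, 0 ≤ S t := by
    intro t
    have h2 : ∀ v : ℝ, 1 ≤ v → 0 ≤ min v θ := fun v hv => le_min (by linarith) (by linarith)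
    exact add_nonneg (h2 _ (hx1 t)) (Finset.sum_nonneg (fun i _ => h2 _ (hq1 _)))
  have hSs : ∀ t, S (t + 1) + (min (x t) θ + min (q t) θ) =
      S t + (min (x (t + 1)) θ + min (x t + q t) θ) := by
    intro t
    have := sum_shift n (fun i => min (q i) θ) t
    rw [hR.2 t] at this
    simp only [hS]
    linarith
  have hds : ∀ t, d (t + 1) + ((if x t < θ then 1 else 0) + (if q t < θ then 1 else 0)) =
      d t + ((if x (t + 1) < θ then 1 else 0) + (if x t + q t < θ then 1 else 0)) := by
    intro t
    have := sum_shift n (fun i => if q i < θ then 1 else 0) t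
    rw [show q (t + n) = x t + q t from hR.2 t] at this
    simp only [hd, cnt]
    omega
  have hd0 : d 0 ≤ n + 1 := by
    simp only [hd, cnt]
    have : ∑ i ∈ Finset.range n, (if q (0 + i) < θ then 1 else 0) ≤ ∑ i ∈ Finset.range n, 1 :=
      Finset.sum_le_sum (fun i _ => by split <;> omega)
    simp only [Finset.sum_const, Finset.card_range, smul_eq_mul, mul_one] at this
    have : (if x 0 < θ then 1 else 0) ≤ 1 := by split <;> omega
    omega
  set V : ℝ → ℕ → ℕ → ℝ := fun M t b => M + n * ((n + 1) * θ - S t) +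
    (if x t < θ then ((b:ℝ) - t) * x t else 0) with hV
  set E : ℕ → ℕ → ℕ := fun t b => (n + 2) * d t + (if x t < θ then 0 else b - t + 1) with hE
  have hVge : ∀ M t b, t ≤ b → M ≤ V M t b := by
    intro M t b hb
    have a1 : 0 ≤ (n:ℝ) * ((n + 1) * θ - S t) :=
      mul_nonneg (by linarith) (by linarith [hSle t])
    have a2 : 0 ≤ (if x t < θ then ((b:ℝ) - t) * x t else 0) := by
      split
      · have : (t:ℝ) ≤ b := by exact_mod_cast hb
        exact mul_nonneg (by linarith) (by linarith [hx1 t])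
      · exact le_rfl
    simp only [hV]; linarith
  -- generic upper bound
  have hVle : ∀ M t b, b < t + n → V M t b ≤ M + n * ((n + 1) * θ - S t) + n * θ := by
    intro M t b hb
    have a2 : (if x t < θ then ((b:ℝ) - t) * x t else 0) ≤ n * θ := by
      split
      · have : (b:ℝ) < t + n := by exact_mod_cast hb
        have := hx1 t
        nlinarith
      · positivity
    simp only [hV]; linarith
  have key : ∀ t, (∀ s ≤ t, ∃ b, s ≤ b ∧ b < s + n ∧ q b < θ) →
      ∃ b M, t ≤ b ∧ b < t + n ∧ q b < θ ∧ θ ≤ M ∧ Al n x q t (fun v => v ≤ M) ∧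
        ((n:ℝ) + 2) ^ E t b * V M t b ≤ bd n * θ := by
    intro t
    induction t with
    | zero =>
      intro hs
      obtain ⟨b, b1, b2, b3⟩ := hs 0 le_rfl
      refine ⟨b, θ, b1, b2, b3, le_rfl, h0.mono (fun v hv => by rw [hv]; exact hθ), ?_⟩
      have e1 : E 0 b ≤ (n + 2) * (n + 1) + n := by
        simp only [hE]
        have : (n + 2) * d 0 ≤ (n + 2) * (n + 1) := Nat.mul_le_mul_left _ hd0
        split <;> omega
      have e2 : V θ 0 b ≤ (1 + n * (n + 1) + n) * θ := by
        have := hVle θ 0 b b2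
        have := hS0 0
        nlinarith
      have e3 : ((n:ℝ) + 2) ^ E 0 b ≤ ((n:ℝ) + 2) ^ ((n + 2) * (n + 1) + n) :=
        pow_le_pow_right₀ (by linarith) e1
      rw [bd, mul_assoc]
      have := hVge θ 0 b b1
      exact mul_le_mul e3 e2 (by linarith) (by positivity)
    | succ t ih =>
      intro hs
      obtain ⟨b, M, b1, b2, b3, hM, hA, hB⟩ := ih (fun s h => hs s (by omega))
      obtain ⟨b', c1, c2, c3⟩ := hs (t + 1) le_rfl
      have hxM : x t ≤ M := hA.1
      have hqM : q t ≤ M := by simpa using hA.2 0 (by omega)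
      -- two ways to conclude
      have fin0 : ∀ b'' M', t + 1 ≤ b'' → b'' < t + 1 + n → q b'' < θ → M ≤ M' → x t + q t ≤ M' →
          ((n:ℝ) + 2) ^ E (t + 1) b'' * V M' (t + 1) b'' ≤ ((n:ℝ) + 2) ^ E t b * V M t b →
          ∃ b M, t + 1 ≤ b ∧ b < t + 1 + n ∧ q b < θ ∧ θ ≤ M ∧ Al n x q (t + 1) (fun v => v ≤ M) ∧
        ((n:ℝ) + 2) ^ E (t + 1) b * V M (t + 1) b ≤ bd n * θ := by
        intro b'' M' g1 g2 g3 g4 g5 g6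
        refine ⟨b'', M', g1, g2, g3, by linarith, ⟨?_, fun i hi => ?_⟩, g6.trans hB⟩
        · rw [hR.1 t]; split <;> linarith
        · by_cases hi' : i + 1 < n
          · have := hA.2 (i + 1) hi'
            rw [show t + 1 + i = t + (i + 1) by ring]
            linarith
          · rw [show t + 1 + i = t + n by omega, hR.2 t]
            exact g5
      have hVM := hVge M t b b1
      have fin1 : ∀ b'' M', t + 1 ≤ b'' → b'' < t + 1 + n → q b'' < θ → M ≤ M' → x t + q t ≤ M' →
          E (t + 1) b'' ≤ E t b → V M' (t + 1) b'' ≤ V M t b →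
          ∃ b M, t + 1 ≤ b ∧ b < t + 1 + n ∧ q b < θ ∧ θ ≤ M ∧ Al n x q (t + 1) (fun v => v ≤ M) ∧
        ((n:ℝ) + 2) ^ E (t + 1) b * V M (t + 1) b ≤ bd n * θ := by
        intro b'' M' g1 g2 g3 g4 g5 g6 g7
        refine fin0 b'' M' g1 g2 g3 g4 g5 ?_
        have := hVge M' (t + 1) b'' g1
        exact mul_le_mul (pow_le_pow_right₀ (by linarith) g6) g7 (by linarith) (by positivity)
      have fin2 : ∀ b'' M', t + 1 ≤ b'' → b'' < t + 1 + n → q b'' < θ → M ≤ M' → x t + q t ≤ M' →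
          E (t + 1) b'' + 1 ≤ E t b → V M' (t + 1) b'' ≤ (n + 2) * V M t b →
          ∃ b M, t + 1 ≤ b ∧ b < t + 1 + n ∧ q b < θ ∧ θ ≤ M ∧ Al n x q (t + 1) (fun v => v ≤ M) ∧
        ((n:ℝ) + 2) ^ E (t + 1) b * V M (t + 1) b ≤ bd n * θ := by
        intro b'' M' g1 g2 g3 g4 g5 g6 g7
        refine fin0 b'' M' g1 g2 g3 g4 g5 ?_
        have := hVge M' (t + 1) b'' g1
        calc ((n:ℝ) + 2) ^ E (t + 1) b'' * V M' (t + 1) b''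
            ≤ ((n:ℝ) + 2) ^ E (t + 1) b'' * ((n + 2) * V M t b) :=
              mul_le_mul_of_nonneg_left g7 (by positivity)
          _ = ((n:ℝ) + 2) ^ (E (t + 1) b'' + 1) * V M t b := by rw [pow_succ]; ring
          _ ≤ _ := mul_le_mul_of_nonneg_right (pow_le_pow_right₀ (by linarith) g6) (by linarith)
      have hSt := hSs t
      have hdt := hds t
      have hxt := hR.1 t
      have hxp := hx1 t
      have hqp := hq1 t
      have hSmono : S t ≤ S (t + 1) := by
        have m1 : min (x t) θ ≤ min (x t + q t) θ := min_le_min_right _ (by linarith)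
        have m2 : min (q t) θ ≤ min (x t + q t) θ := min_le_min_right _ (by linarith)
        cases hsw : sw t
        · simp only [hsw, Bool.false_eq_true, if_false] at hxt
          rw [hxt] at hSt; linarith
        · simp only [hsw, if_true] at hxt
          rw [hxt] at hSt; linarith
      have hnS : (n:ℝ) * S t ≤ n * S (t + 1) := mul_le_mul_of_nonneg_left hSmono (by linarith)
      -- bound used in the coarse cases
      have coarse : V (M + θ) (t + 1) b' ≤ (n + 2) * V M t b := by
        have e1 := hVle (M + θ) (t + 1) b' c2
        have e2 : M + n * ((n + 1) * θ - S t) ≤ V M t b := by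
          have : 0 ≤ (if x t < θ then ((b:ℝ) - t) * x t else 0) := by
            split
            · have : (t:ℝ) ≤ b := by exact_mod_cast b1
              exact mul_nonneg (by linarith) (by linarith [hx1 t])
            · exact le_rfl
          simp only [hV]; linarith
        have e3 : θ ≤ V M t b := by linarith
        nlinarith
      have hE1 : E (t + 1) b' ≤ (n + 2) * d (t + 1) + n := by
        simp only [hE]; split <;> omega
      have hE2 : (n + 2) * d t ≤ E t b := by simp only [hE]; omega
      have coarseE : d (t + 1) + 1 ≤ d t → E (t + 1) b' + 1 ≤ E t b := by
        intro h
        have : (n + 2) * (d (t + 1) + 1) ≤ (n + 2) * d t := Nat.mul_le_mul_left _ h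
        have e : (n + 2) * (d (t + 1) + 1) = (n + 2) * d (t + 1) + n + 2 := by ring
        omega
      by_cases hx : x t < θ <;> by_cases hq : q t < θ
      · -- both small
        by_cases hxq : x t + q t < θ
        · have hx' : x (t + 1) < θ := by rw [hxt]; split <;> assumption
          rw [min_eq_left hx.le, min_eq_left hq.le, min_eq_left hx'.le, min_eq_left hxq.le] at hSt
          simp only [hx, hq, hx', hxq, if_true] at hdt
          refine fin1 b' M c1 c2 c3 le_rfl (by linarith) ?_ ?_
          · simp only [hE, hx, hx', if_true]
            rw [show d (t + 1) = d t by omega]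
          · have e1 : V M t b ≥ M + n * ((n + 1) * θ - S t) := by
              simp only [hV, hx, if_true]
              have : (t:ℝ) ≤ b := by exact_mod_cast b1
              have : 0 ≤ ((b:ℝ) - t) * x t := mul_nonneg (by linarith) (by linarith)
              linarith
            have e2 : V M (t + 1) b' ≤ M + n * ((n + 1) * θ - S (t + 1)) + n * x (t + 1) := by
              simp only [hV, hx', if_true]
              have : (b':ℝ) < t + 1 + n := by exact_mod_cast c2
              have := hx1 (t + 1)
              push_cast
              nlinarith
            have e3 : S (t + 1) = S t + x (t + 1) := by linarith
            rw [e3] at e2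
            linarith
        · refine fin2 b' (M + θ) c1 c2 c3 (by linarith) (by linarith) (coarseE ?_) coarse
          have hx' : x (t + 1) < θ := by rw [hxt]; split <;> assumption
          simp only [hx, hq, hx', hxq, if_true, if_false] at hdt
          omega
      · have hxq : ¬ x t + q t < θ := by linarith
        have hbt : t + 1 ≤ b := by
          rcases Nat.lt_or_ge t b with h | h
          · exact h
          · rw [show b = t by omega] at b3; exact absurd b3 hq
        cases hsw : sw t
        · simp only [hsw, Bool.false_eq_true, if_false] at hxt
          have hx' : x (t + 1) < θ := by rw [hxt]; exact hx
          simp only [hx, hq, hx', hxq, if_true, if_false] at hdt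
          refine fin1 b (M + x t) hbt (by omega) b3 (by linarith) (by linarith) ?_ ?_
          · simp only [hE, hx, hx', if_true]
            rw [show d (t + 1) = d t by omega]
          · simp only [hV, hx, hx', if_true]
            rw [hxt]
            push_cast
            linarith
        · simp only [hsw, if_true] at hxt
          refine fin2 b' (M + θ) c1 c2 c3 (by linarith) (by linarith) (coarseE ?_) coarse
          have hx' : ¬ x (t + 1) < θ := by rw [hxt]; exact hq
          simp only [hx, hq, hx', hxq, if_true, if_false] at hdt
          omega
      · have hxq : ¬ x t + q t < θ := by linarith
        cases hsw : sw t
        · simp only [hsw, Bool.false_eq_true, if_false] at hxt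
          refine fin2 b' (M + θ) c1 c2 c3 (by linarith) (by linarith) (coarseE ?_) coarse
          have hx' : ¬ x (t + 1) < θ := by rw [hxt]; exact hx
          simp only [hx, hq, hx', hxq, if_true, if_false] at hdt
          omega
        · simp only [hsw, if_true] at hxt
          have hx' : x (t + 1) < θ := by rw [hxt]; exact hq
          simp only [hx, hq, hx', hxq, if_true, if_false] at hdt
          refine fin2 b' (M + θ) c1 c2 c3 (by linarith) (by linarith) ?_ coarse
          simp only [hE, hx, hx', if_true, if_false]
          rw [show d (t + 1) = d t by omega]
          omega
      · have hxq : ¬ x t + q t < θ := by linarith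
        have hbt : t + 1 ≤ b := by
          rcases Nat.lt_or_ge t b with h | h
          · exact h
          · rw [show b = t by omega] at b3; exact absurd b3 hq
        have hx' : ¬ x (t + 1) < θ := by rw [hxt]; split <;> assumption
        simp only [hx, hq, hx', hxq, if_false] at hdt
        refine fin2 b (M + M) hbt (by omega) b3 (by linarith) (by linarith) ?_ ?_
        · simp only [hE, hx, hx', if_false]
          rw [show d (t + 1) = d t by omega]
          omega
        · simp only [hV, hx, hx', if_false]
          have := hSle t
          have : 0 ≤ (n:ℝ) * ((n + 1) * θ - S t) := mul_nonneg (by linarith) (by linarith)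
          nlinarith
  obtain ⟨b, M, b1, b2, b3, hM, hA, hB⟩ := key t ht
  refine hA.mono (fun v hv => ?_)
  have e1 := hVge M t b b1
  have e2 : (1:ℝ) ≤ ((n:ℝ) + 2) ^ E t b := one_le_pow₀ (by linarith)
  nlinarith

lemma q_large {n : ℕ} (hn : 1 ≤ n) {sw : ℕ → Bool} {x q : ℕ → ℝ}
    (hR : Rec (fun a b => a + b) n sw x q) (h0 : Al n x q 0 (fun v => v = 1)) (k : ℕ) :
    ∀ t, n * k ≤ t → (k:ℝ) ≤ q t := by
  have h1 := ge_one hn hR h0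
  induction k with
  | zero =>
    intro t _
    have : 1 ≤ q t := by simpa using (h1 t).2 0 (by omega)
    simp; linarith
  | succ k ih =>
    intro t ht
    have e : n * (k + 1) = n * k + n := by ring
    have := ih (t - n) (by omega)
    have h2 : q (t - n + n) = x (t - n) + q (t - n) := hR.2 (t - n)
    rw [show t - n + n = t by omega] at h2
    have := (h1 (t - n)).1
    push_cast; linarith

lemma le_two_pow {n : ℕ} (hn : 1 ≤ n) {sw : ℕ → Bool} {x q : ℕ → ℝ}
    (hR : Rec (fun a b => a + b) n sw x q) (h0 : Al n x q 0 (fun v => v = 1)) (t : ℕ) :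
    Al n x q t (fun v => v ≤ 2 ^ t) := by
  induction t with
  | zero => exact h0.mono (fun v hv => by simp [hv])
  | succ t ih =>
    refine ih.step' hR hn ?_ ?_
    · intro a b ha hb
      rw [pow_succ]; linarith
    · intro a ha
      have : (0:ℝ) < 2 ^ t := by positivity
      rw [pow_succ]; linarith

lemma bd_ge (n : ℕ) : 1 ≤ bd n := by
  have h : (0:ℝ) ≤ n := Nat.cast_nonneg n
  have : (1:ℝ) ≤ ((n:ℝ) + 2) ^ ((n + 2) * (n + 1) + n) := one_le_pow₀ (by linarith)
  rw [bd]
  nlinarith [mul_nonneg h h]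

lemma good_time {n : ℕ} (hn : 1 ≤ n) {sw : ℕ → Bool} {x q : ℕ → ℝ}
    (hR : Rec (fun a b => a + b) n sw x q) (h0 : Al n x q 0 (fun v => v = 1))
    (hsw : ∀ T, ∃ t, T ≤ t ∧ sw t = true) (T0 : ℕ) :
    ∃ T, T0 ≤ T ∧ ∃ m, 0 < m ∧ Al n x q T (fun v => m ≤ v ∧ v ≤ (4 * bd n) * m) := by
  classical
  set θ : ℝ := 2 ^ T0 + 1 with hθd
  have hp : (0:ℝ) < 2 ^ T0 := by positivity
  have hθ : 1 ≤ θ := by linarith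
  have hbd := bd_ge n
  have hx1 : ∀ t, 1 ≤ x t := fun t => (ge_one hn hR h0 t).1
  have hex : ∃ t, ∀ b, t ≤ b → b < t + n → θ ≤ q b := by
    obtain ⟨k, hk⟩ := exists_nat_ge θ
    exact ⟨n * k, fun b hb _ => hk.trans (q_large hn hR h0 k b hb)⟩
  set t0 := Nat.find hex with ht0
  have hfind := Nat.find_spec hex
  have hmin : ∀ s < t0, ∃ b, s ≤ b ∧ b < s + n ∧ q b < θ := by
    intro s hs
    have := Nat.find_min hex hs
    push Not at this
    exact this
  rw [← ht0] at hfind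
  have hT0 : T0 < t0 := by
    by_contra h
    have h2 := (le_two_pow hn hR h0 t0).2 0 (by omega)
    have h3 := hfind t0 le_rfl (by omega)
    have h4 : (2:ℝ) ^ t0 ≤ 2 ^ T0 := pow_le_pow_right₀ (by norm_num) (by omega)
    simp only [add_zero] at h2
    linarith
  have hW := weight_bound hn hR h0 θ hθ (t0 - 1) (fun s hs => hmin s (by omega))
  have hA : Al n x q t0 (fun v => v ≤ 2 * bd n * θ) := by
    have := hW.step' (p' := fun v => v ≤ 2 * bd n * θ) hR hn (fun a b ha hb => by linarith)
      (fun a ha => by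
        have : 0 ≤ bd n * θ := by positivity
        linarith)
    rwa [show t0 - 1 + 1 = t0 by omega] at this
  -- next switch
  have hex2 : ∃ k, sw (t0 + k) = true := by
    obtain ⟨t, h1, h2⟩ := hsw t0
    exact ⟨t - t0, by rwa [show t0 + (t - t0) = t by omega]⟩
  set k := Nat.find hex2 with hk
  have hksw : sw (t0 + k) = true := Nat.find_spec hex2
  have hkmin : ∀ i < k, sw (t0 + i) = false := by
    intro i hi
    have := Nat.find_min hex2 hi
    simpa using this
  have hxc : ∀ i ≤ k, x (t0 + i) = x t0 := by
    intro i
    induction i with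
    | zero => intro _; rfl
    | succ i ih =>
      intro hi
      have h1 := hR.1 (t0 + i)
      rw [hkmin i (by omega)] at h1
      simp only [Bool.false_eq_true, if_false] at h1
      rw [← ih (by omega), ← h1]; rfl
  set X := x t0 with hX
  have hXb : X ≤ 2 * bd n * θ := hA.1
  have hX1 : 1 ≤ X := hx1 t0
  have hq : ∀ u, u ≤ k + n → θ + (u / n : ℕ) * X ≤ q (t0 + u) ∧
      q (t0 + u) ≤ 2 * bd n * θ + (u / n : ℕ) * X := by
    intro u
    induction u using Nat.strong_induction_on with
    | _ u ih =>
      intro hu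
      by_cases hun : u < n
      · rw [Nat.div_eq_of_lt hun]
        have h1 := hfind (t0 + u) (by omega) (by omega)
        have h2 := hA.2 u hun
        simp only [Nat.cast_zero, zero_mul, add_zero]
        exact ⟨h1, h2⟩
      · obtain ⟨v, rfl⟩ : ∃ v, u = v + n := ⟨u - n, by omega⟩
        have h1 := ih v (by omega) (by omega)
        have h2 : q (t0 + v + n) = x (t0 + v) + q (t0 + v) := hR.2 (t0 + v)
        rw [hxc v (by omega)] at h2
        rw [Nat.add_div_right _ (by omega), ← add_assoc, h2]
        push_cast
        constructor <;> linarith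
  have hj : (0:ℝ) ≤ (k / n : ℕ) := Nat.cast_nonneg _
  have hjX : 0 ≤ ((k / n : ℕ) : ℝ) * X := mul_nonneg hj (by linarith)
  have hq' : ∀ u, k ≤ u → u ≤ k + n → θ + (k / n : ℕ) * X ≤ q (t0 + u) ∧
      q (t0 + u) ≤ 4 * bd n * (θ + (k / n : ℕ) * X) := by
    intro u hu1 hu2
    obtain ⟨h1, h2⟩ := hq u hu2
    have e1 : k / n ≤ u / n := Nat.div_le_div_right hu1
    have e2 : u / n ≤ k / n + 1 := by
      rw [← Nat.add_div_right _ (by omega)]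
      exact Nat.div_le_div_right hu2
    have e1' : ((k / n : ℕ) : ℝ) ≤ (u / n : ℕ) := by exact_mod_cast e1
    have e2' : ((u / n : ℕ) : ℝ) ≤ (k / n : ℕ) + 1 := by exact_mod_cast e2
    have f1 : ((k / n : ℕ) : ℝ) * X ≤ (u / n : ℕ) * X :=
      mul_le_mul_of_nonneg_right e1' (by linarith)
    have f2 : ((u / n : ℕ) : ℝ) * X ≤ ((k / n : ℕ) + 1) * X :=
      mul_le_mul_of_nonneg_right e2' (by linarith)
    have f3 : ((k / n : ℕ) : ℝ) * X ≤ bd n * (((k / n : ℕ) : ℝ) * X) := by nlinarith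
    constructor
    · linarith
    · nlinarith
  refine ⟨t0 + k + 1, by omega, θ + (k / n : ℕ) * X, by linarith, ?_, ?_⟩
  · rw [hR.1 (t0 + k), hksw]
    exact hq' k le_rfl (by omega)
  · intro i hi
    rw [show t0 + k + 1 + i = t0 + (k + 1 + i) by ring]
    exact hq' _ (by omega) (by omega)

lemma osc_small {n : ℕ} (hn : 1 ≤ n) {sw : ℕ → Bool} {x q : ℕ → ℝ × ℝ}
    (hR : Rec (fun a b => a + b) n sw x q)
    (h0 : Al n x q 0 (fun v => v.2 = 1 ∧ 0 ≤ v.1 ∧ v.1 ≤ 1)) (ε : ℝ) (hε : 0 < ε) :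
    ∃ t, Osc n x q t ε := by
  have hRw : Rec (fun a b : ℝ => a + b) n sw (fun t => (x t).2) (fun t => (q t).2) :=
    hR.map (fun v => v.2) (fun a b => rfl)
  have h0w : Al n (fun t => (x t).2) (fun t => (q t).2) 0 (fun v => v = 1) :=
    ⟨h0.1.1, fun i hi => (h0.2 i hi).1⟩
  have hw1 := ge_one hn hRw h0w
  by_cases hsw : ∀ T, ∃ t, T ≤ t ∧ sw t = true
  · obtain ⟨η, e0, e1, H⟩ := contract' hn (4 * bd n) (by linarith [bd_ge n])
    have key : ∀ k : ℕ, ∃ t, Osc n x q t ((1 - η) ^ k) := by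
      intro k
      induction k with
      | zero =>
        refine ⟨0, 0, h0.mono ?_⟩
        rintro ⟨g, w⟩ ⟨h1, h2, h3⟩
        simp only at *
        subst h1
        constructor <;> simp <;> linarith
      | succ k ih =>
        obtain ⟨t, ht⟩ := ih
        obtain ⟨T, hT, m, hm, hA⟩ := good_time hn hRw h0w hsw t
        refine ⟨T + 2 * n * (n + 2), ?_⟩
        rw [pow_succ']
        exact H sw x q hR m T hm hA _ (pow_pos (by linarith) k) (ht.step hn hR T hT)
    obtain ⟨k, hk⟩ := exists_pow_lt_of_lt_one hε (show 1 - η < 1 by linarith)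
    obtain ⟨t, α, ht⟩ := key k
    have hw := hw1 t
    refine ⟨t, α, ⟨ht.1.1, ht.1.2.trans ?_⟩, fun i hi => ⟨(ht.2 i hi).1, (ht.2 i hi).2.trans ?_⟩⟩
    · have := hw.1
      exact mul_le_mul_of_nonneg_right (by linarith) (by linarith)
    · have := hw.2 i hi
      exact mul_le_mul_of_nonneg_right (by linarith) (by linarith)
  · push Not at hsw
    obtain ⟨T, hT⟩ := hsw
    have hxc : ∀ t, T ≤ t → x t = x T := by
      intro t ht
      induction t, ht using Nat.le_induction with
      | base => rfl
      | succ t ht ih =>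
        rw [hR.1 t, ← ih]
        simp [hT t ht]
    set r : ℝ := (x T).1 / (x T).2 with hr
    have hxT : 1 ≤ (x T).2 := (hw1 T).1
    have hrx : (x T).1 = r * (x T).2 := by rw [hr]; field_simp
    set D : ℝ := ∑ i ∈ Finset.range n, |(q (T + i)).1 - r * (q (T + i)).2| with hD
    have hD1 : ∀ u, |(q (T + u)).1 - r * (q (T + u)).2| ≤ D := by
      intro u
      induction u using Nat.strong_induction_on with
      | _ u ih =>
        by_cases hun : u < n
        · exact Finset.single_le_sum
            (f := fun i => |(q (T + i)).1 - r * (q (T + i)).2|)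
            (fun i _ => abs_nonneg _) (Finset.mem_range.2 hun)
        · obtain ⟨v, rfl⟩ : ∃ v, u = v + n := ⟨u - n, by omega⟩
          have h1 := ih v (by omega)
          have h2 : q (T + v + n) = x (T + v) + q (T + v) := hR.2 (T + v)
          rw [hxc (T + v) (by omega)] at h2
          rw [← add_assoc, h2]
          simp only [Prod.fst_add, Prod.snd_add]
          rw [show (x T).1 + (q (T + v)).1 - r * ((x T).2 + (q (T + v)).2) =
            (q (T + v)).1 - r * (q (T + v)).2 by rw [hrx]; ring]
          exact h1
    obtain ⟨k, hk⟩ := exists_nat_ge (D / (ε / 2))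
    rw [div_le_iff₀ (by positivity)] at hk
    refine ⟨T + n * k, r - ε / 2, ⟨?_, ?_⟩, fun i hi => ?_⟩
    · rw [hxc _ (by omega)]; nlinarith
    · rw [hxc _ (by omega)]; nlinarith
    · have h1 := hD1 (n * k + i)
      have h2 := q_large hn hRw h0w k (T + (n * k + i)) (by omega)
      rw [abs_le] at h1
      rw [show T + n * k + i = T + (n * k + i) by ring]
      constructor <;> nlinarith

lemma one_ne {n : ℕ} (hn : 1 ≤ n) : (1 : Fin (n + 1)) ≠ 0 := by
  intro h
  have := congrArg Fin.val h
  rw [Fin.val_one' , Fin.val_zero] at this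
  rw [Nat.mod_eq_of_lt (by omega)] at this
  omega

lemma mul_F {n : ℕ} (Q : MatZ n) (i j : Fin (n + 1)) :
    (Q * Fmat n) i j = Q i (Equiv.swap 0 1 j) := by
  simp [Matrix.mul_apply, Fmat]

lemma mul_R {n : ℕ} (Q : MatZ n) (i j : Fin (n + 1)) :
    (Q * Rmat n) i j = Q i (j + 1) := by
  simp [Matrix.mul_apply, Rmat]

lemma mul_N {n : ℕ} (hn : 1 ≤ n) (Q : MatZ n) (i j : Fin (n + 1)) :
    (Q * Nmat n) i j = Q i j + if j = 1 then Q i 0 else 0 := by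
  have h1 := one_ne hn
  have : ∀ k, Q i k * Nmat n k j = (if k = j then Q i k else 0) +
      (if k = 0 then (if j = 1 then Q i k else 0) else 0) := by
    intro k
    simp only [Nmat, Matrix.of_apply]
    by_cases hkj : k = j
    · subst hkj
      by_cases hk : k = 0
      · subst hk; simp [h1.symm]
      · simp [hk]
    · rw [if_neg hkj, if_neg hkj, zero_add]
      by_cases hk : k = 0
      · by_cases hj : j = 1
        · rw [if_pos ⟨hj, hk⟩, if_pos hk, if_pos hj, mul_one]
        · rw [if_neg (fun h => hj h.1), if_pos hk, if_neg hj, mul_zero]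
      · rw [if_neg (fun h => hk h.2), if_neg hk, mul_zero]
  rw [Matrix.mul_apply, Finset.sum_congr rfl (fun k _ => this k), Finset.sum_add_distrib]
  simp

lemma mul_M0 {n : ℕ} (hn : 1 ≤ n) (Q : MatZ n) (i j : Fin (n + 1)) :
    (Q * Mon0 n) i j = Q i (Equiv.swap 0 1 (j + 1)) + if j + 1 = 0 then Q i 0 else 0 := by
  rw [Mon0, ← Matrix.mul_assoc, ← Matrix.mul_assoc, mul_R, mul_F, mul_N hn]
  congr 1
  have : Equiv.swap (0 : Fin (n+1)) 1 (j + 1) = 1 ↔ j + 1 = 0 := by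
    rw [← Equiv.eq_symm_apply]
    simp
  simp [this]

lemma mul_M1 {n : ℕ} (hn : 1 ≤ n) (Q : MatZ n) (i j : Fin (n + 1)) :
    (Q * Mon1 n) i j = Q i (j + 1) + if j + 1 = 0 then Q i 1 else 0 := by
  rw [Mon1, Lmat, ← Matrix.mul_assoc, ← Matrix.mul_assoc, ← Matrix.mul_assoc, mul_R, mul_F,
    mul_N hn, mul_F, mul_F]
  have : Equiv.swap (0 : Fin (n+1)) 1 (j + 1) = 1 ↔ j + 1 = 0 := by
    rw [← Equiv.eq_symm_apply]
    simp
  simp [this]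

lemma FF {n : ℕ} : Fmat n * Fmat n = 1 := by
  ext i j
  rw [mul_F]
  simp [Fmat, Matrix.one_apply]

lemma F_M0 (n : ℕ) : Fmat n * Mon0 n = Mon1 n := by
  simp only [Mon0, Mon1, Lmat, Matrix.mul_assoc]

lemma F_M1 (n : ℕ) : Fmat n * Mon1 n = Mon0 n := by
  rw [← F_M0, ← Matrix.mul_assoc, FF, Matrix.one_mul]

def Mb (n : ℕ) (b : Bool) : MatZ n := bif b then Mon1 n else Mon0 n
def Fe (n : ℕ) (b : Bool) : MatZ n := bif b then Fmat n else 1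

lemma Fe_Mb (n : ℕ) (e b : Bool) : Fe n e * Mb n b = Mb n (xor b e) := by
  cases e <;> cases b <;> simp [Fe, Mb, F_M0, F_M1]

lemma wp_succ {n : ℕ} (A0 A1 : MatZ n) (a : ℕ → Bool) (t : ℕ) :
    wordProd A0 A1 ((List.range (t + 1)).map a) =
      wordProd A0 A1 ((List.range t).map a) * (bif a t then A1 else A0) := by
  simp [wordProd, List.range_succ]

lemma reduce {n : ℕ} (e : Bool → Bool) (A0 A1 : MatZ n)
    (hA : ∀ b : Bool, (bif b then A1 else A0) = Mb n b * Fe n (e b)) (a : ℕ → Bool) :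
    ∃ sw : ℕ → Bool, ∀ t, ∃ b, wordProd A0 A1 ((List.range t).map a) =
      wordProd (Mon0 n) (Mon1 n) ((List.range t).map sw) * Fe n b := by
  let ε : ℕ → Bool := fun t => match t with
    | 0 => false
    | t + 1 => e (a t)
  refine ⟨fun t => xor (a t) (ε t), fun t => ⟨ε t, ?_⟩⟩
  induction t with
  | zero => simp [wordProd, ε, Fe]
  | succ t ih =>
    rw [wp_succ, wp_succ, ih, hA, Matrix.mul_assoc, ← Matrix.mul_assoc (Fe n _), Fe_Mb]
    simp only [Matrix.mul_assoc]
    rfl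

lemma col_rec {n : ℕ} (hn : 1 ≤ n) (sw : ℕ → Bool) :
    ∃ x q : ℕ → (Fin (n + 1) → ℝ), Rec (fun a b => a + b) n sw x q ∧
      ∀ t (p : (Fin (n + 1) → ℝ) → Prop), Al n x q t p ↔
        ∀ j, p (fun i => (wordProd (Mon0 n) (Mon1 n) ((List.range t).map sw) i j : ℝ)) := by
  set Q : ℕ → MatZ n := fun t => wordProd (Mon0 n) (Mon1 n) ((List.range t).map sw) with hQ
  have hQs : ∀ t, Q (t + 1) = Q t * (bif sw t then Mon1 n else Mon0 n) := fun t => wp_succ _ _ _ _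
  have h10 := one_ne hn
  have hone : (1 : Fin (n + 1)) = ⟨0 + 1, by omega⟩ := by
    apply Fin.ext; rw [Fin.val_one', Nat.mod_eq_of_lt (by omega)]
  have hsucc : ∀ i (h : i + 1 < n + 1), (⟨i, by omega⟩ : Fin (n + 1)) + 1 = ⟨i + 1, h⟩ := by
    intro i h
    apply Fin.ext
    rw [Fin.val_add, Fin.val_one', Nat.mod_eq_of_lt (show 1 < n + 1 by omega)]
    exact Nat.mod_eq_of_lt h
  have hlast : (⟨n, by omega⟩ : Fin (n + 1)) + 1 = 0 := by
    apply Fin.ext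
    rw [Fin.val_add, Fin.val_one', Nat.mod_eq_of_lt (show 1 < n + 1 by omega)]
    simp
  let X : ℕ → Fin (n + 1) → ℝ := fun t i => (Q t i 0 : ℝ)
  let Y : ℕ → ℕ → Fin (n + 1) → ℝ := fun t k i =>
    if h : k + 1 < n + 1 then (Q t i ⟨k + 1, h⟩ : ℝ) else 0
  have hY0 : ∀ t i, Y t 0 i = (Q t i 1 : ℝ) := by
    intro t i
    simp only [Y]
    rw [dif_pos (by omega), hone]
  obtain ⟨hR, hk⟩ := rec_of_state (op := fun a b => a + b) hn (sw := sw) X Y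
    (by
      intro t
      funext i
      simp only [X, hQs]
      cases hs : sw t
      · simp [mul_M0 hn, h10]
      · simp [mul_M1 hn, h10, hY0])
    (by
      intro t k hk
      funext i
      have h1 : (⟨k + 1 + 1, by omega⟩ : Fin (n + 1)) ≠ 0 := by
        intro h; have := congrArg Fin.val h; simp at this
      have h2 : (⟨k + 1 + 1, by omega⟩ : Fin (n + 1)) ≠ 1 := by
        rw [hone]; intro h; have := congrArg Fin.val h; simp at this
      simp only [Y, hQs]
      rw [dif_pos (by omega), dif_pos (by omega)]
      cases hs : sw t
      · simp only [cond_false, mul_M0 hn]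
        rw [hsucc (k + 1) (by omega), if_neg h1, Equiv.swap_apply_of_ne_of_ne h1 h2, add_zero]
      · simp only [cond_true, mul_M1 hn]
        rw [hsucc (k + 1) (by omega), if_neg h1, add_zero])
    (by
      intro t
      funext i
      have h3 : (⟨n - 1 + 1, by omega⟩ : Fin (n + 1)) + 1 = 0 := by
        rw [← hlast]; congr 2; omega
      simp only [Pi.add_apply, hY0]
      simp only [Y, hQs, X]
      rw [dif_pos (by omega)]
      cases hs : sw t
      · simp only [cond_false, mul_M0 hn]
        rw [h3, if_pos rfl, Equiv.swap_apply_left]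
        push_cast; ring
      · simp only [cond_true, mul_M1 hn]
        rw [h3, if_pos rfl]
        push_cast; ring)
  refine ⟨X, fun t => Y t 0, hR, fun t p => ⟨fun h j => ?_, fun h => ⟨h 0, fun i hi => ?_⟩⟩⟩
  · obtain ⟨j, hj⟩ := j
    rcases j with _ | j
    · exact h.1
    · have := h.2 j (by omega)
      simp only at this
      rw [← hk j (by omega) t] at this
      simp only [Y, hj, dif_pos] at this
      exact this
  · simp only
    rw [← hk i hi t]
    simp only [Y, show i + 1 < n + 1 by omega, dif_pos]
    exact h _

def NN {n : ℕ} (A : MatZ n) : Prop := (∀ i j, 0 ≤ A i j) ∧ ∀ j, 1 ≤ ∑ i, A i j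

lemma NN.pos {n : ℕ} {A : MatZ n} (hA : NN A) {u : Fin (n + 1) → ℝ}
    (hu : u ∈ stdSimplex ℝ (Fin (n + 1))) :
    (∀ i, 0 ≤ (toR A *ᵥ u) i) ∧ 1 ≤ ∑ i, (toR A *ᵥ u) i := by
  have h1 : ∀ i j, (0:ℝ) ≤ toR A i j := fun i j => by
    simp only [toR, Matrix.map_apply]; exact_mod_cast hA.1 i j
  refine ⟨fun i => ?_, ?_⟩
  · simp only [Matrix.mulVec, dotProduct]
    exact Finset.sum_nonneg (fun j _ => mul_nonneg (h1 i j) (hu.1 j))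
  · simp only [Matrix.mulVec, dotProduct]
    rw [Finset.sum_comm]
    rw [← hu.2]
    apply Finset.sum_le_sum
    intro j _
    rw [← Finset.sum_mul]
    have : (1:ℝ) ≤ ∑ i, toR A i j := by
      simp only [toR, Matrix.map_apply]; exact_mod_cast hA.2 j
    have := hu.1 j
    nlinarith

lemma NN.mul {n : ℕ} {A B : MatZ n} (hA : NN A) (hB : NN B) : NN (A * B) := by
  refine ⟨fun i j => ?_, fun j => ?_⟩
  · rw [Matrix.mul_apply]
    exact Finset.sum_nonneg (fun k _ => mul_nonneg (hA.1 _ _) (hB.1 _ _))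
  · simp only [Matrix.mul_apply]
    rw [Finset.sum_comm]
    refine (hB.2 j).trans (Finset.sum_le_sum (fun k _ => ?_))
    rw [← Finset.sum_mul]
    have := hA.2 k
    have := hB.1 k j
    nlinarith

lemma NN.one {n : ℕ} : NN (1 : MatZ n) := by
  refine ⟨fun i j => ?_, fun j => ?_⟩
  · rw [Matrix.one_apply]; split <;> norm_num
  · simp [Matrix.one_apply]

lemma NN.F {n : ℕ} : NN (Fmat n) := by
  refine ⟨fun i j => ?_, fun j => ?_⟩
  · simp only [Fmat, Matrix.of_apply]; split <;> norm_num
  · simp [Fmat]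

lemma NN.R {n : ℕ} : NN (Rmat n) := by
  refine ⟨fun i j => ?_, fun j => ?_⟩
  · simp only [Rmat, Matrix.of_apply]; split <;> norm_num
  · simp [Rmat]

lemma NN.N {n : ℕ} : NN (Nmat n) := by
  have h : ∀ i j, 0 ≤ Nmat n i j := by
    intro i j
    simp only [Nmat, Matrix.of_apply]; split
    · norm_num
    · split <;> norm_num
  refine ⟨h, fun j => ?_⟩
  have : Nmat n j j ≤ ∑ i, Nmat n i j :=
    Finset.single_le_sum (f := fun i => Nmat n i j) (fun i _ => h i j) (Finset.mem_univ j)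
  simpa [Nmat] using this

lemma NN.Mb {n : ℕ} (b : Bool) : NN (Mb n b) := by
  cases b
  · exact (NN.N.mul NN.F).mul NN.R
  · exact ((NN.F.mul NN.N).mul NN.F).mul NN.R

lemma NN.Fe {n : ℕ} (b : Bool) : NN (Fe n b) := by
  cases b
  · exact NN.one
  · exact NN.F

lemma toR_mul {n : ℕ} (A B : MatZ n) : toR (A * B) = toR A * toR B := by
  ext i j
  simp [toR, Matrix.mul_apply]

lemma simg_mul {n : ℕ} {P A : MatZ n} (hA : NN A) : simg (P * A) ⊆ simg P := by
  rintro y ⟨u, hu, rfl⟩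
  obtain ⟨h1, h2⟩ := hA.pos hu
  set s := ∑ i, (toR A *ᵥ u) i with hs
  refine ⟨s⁻¹ • (toR A *ᵥ u), ⟨fun i => ?_, ?_⟩, ?_⟩
  · exact mul_nonneg (by positivity) (h1 i)
  · simp only [Pi.smul_apply, smul_eq_mul]
    rw [← Finset.mul_sum, ← hs, inv_mul_cancel₀ (by linarith)]
  · have hs0 : s ≠ 0 := by linarith
    simp only [projAct, toR_mul, Matrix.mulVec_smul, Matrix.mulVec_mulVec, Pi.smul_apply,
      smul_eq_mul, ← Finset.mul_sum, smul_smul]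
    rw [mul_inv, inv_inv]
    congr 1
    field_simp

lemma simg_compact {n : ℕ} {P : MatZ n} (hP : NN P) : IsCompact (simg P) := by
  refine (isCompact_stdSimplex ℝ (Fin (n + 1))).image_of_continuousOn ?_
  unfold projAct
  have hc : Continuous (fun x : Fin (n + 1) → ℝ => toR P *ᵥ x) :=
    Continuous.matrix_mulVec continuous_const continuous_id
  have hc2 : Continuous (fun x : Fin (n + 1) → ℝ => ∑ i, (toR P *ᵥ x) i) :=
    continuous_finsetSum _ (fun i _ => (continuous_apply i).comp hc)
  have hc3 : ContinuousOn (fun x : Fin (n + 1) → ℝ => (∑ i, (toR P *ᵥ x) i)⁻¹)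
      (stdSimplex ℝ (Fin (n + 1))) := by
    refine ContinuousOn.inv₀ hc2.continuousOn ?_
    intro u hu
    have := (hP.pos hu).2
    linarith
  exact ContinuousOn.smul hc3 hc.continuousOn

lemma simg_nonempty {n : ℕ} (P : MatZ n) : (simg P).Nonempty :=
  ⟨_, _, single_mem_stdSimplex ℝ 0, rfl⟩

lemma simg_bound {n : ℕ} {P : MatZ n} (hP : NN P) (i : Fin (n + 1)) (α δ : ℝ)
    (h : ∀ j, α * (∑ k, (P k j : ℝ)) ≤ P i j ∧ (P i j : ℝ) ≤ (α + δ) * (∑ k, (P k j : ℝ)))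
    (y : Fin (n + 1) → ℝ) (hy : y ∈ simg P) : α ≤ y i ∧ y i ≤ α + δ := by
  obtain ⟨u, hu, rfl⟩ := hy
  obtain ⟨h1, h2⟩ := hP.pos hu
  have hs : ∑ k, (toR P *ᵥ u) k = ∑ j, (∑ k, (P k j : ℝ)) * u j := by
    simp only [Matrix.mulVec, dotProduct, toR, Matrix.map_apply]
    rw [Finset.sum_comm]
    simp only [Finset.sum_mul]
  have hi : (toR P *ᵥ u) i = ∑ j, (P i j : ℝ) * u j := by
    simp only [Matrix.mulVec, dotProduct, toR, Matrix.map_apply]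
  simp only [projAct, Pi.smul_apply, smul_eq_mul]
  rw [inv_mul_eq_div, le_div_iff₀ (by linarith), div_le_iff₀ (by linarith), hs, hi,
    Finset.mul_sum, Finset.mul_sum]
  constructor <;> apply Finset.sum_le_sum <;> intro j _ <;> rw [← mul_assoc]
  · exact mul_le_mul_of_nonneg_right (h j).1 (hu.1 j)
  · exact mul_le_mul_of_nonneg_right (h j).2 (hu.1 j)

lemma main {n : ℕ} (hn : 1 ≤ n) (e : Bool → Bool) (A0 A1 : MatZ n)
    (hA : ∀ b : Bool, (bif b then A1 else A0) = Mb n b * Fe n (e b)) : Contractive A0 A1 := by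
  intro a
  set P : ℕ → MatZ n := fun t => wordProd A0 A1 ((List.range t).map a) with hP
  have hPs : ∀ t, P (t + 1) = P t * (Mb n (a t) * Fe n (e (a t))) := fun t => by
    rw [← hA]; exact wp_succ _ _ _ _
  have hNA : ∀ t, NN (Mb n (a t) * Fe n (e (a t))) := fun t => (NN.Mb _).mul (NN.Fe _)
  have hNP : ∀ t, NN (P t) := by
    intro t
    induction t with
    | zero => simpa [hP, wordProd] using NN.one
    | succ t ih => rw [hPs]; exact ih.mul (hNA t)
  have hne : (⋂ t, simg (P t)).Nonempty :=
    IsCompact.nonempty_iInter_of_sequence_nonempty_isCompact_isClosed (fun t => simg (P t))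
      (fun t => by simp only [hPs]; exact simg_mul (hNA t)) (fun t => simg_nonempty _)
      (simg_compact (hNP 0)) (fun t => (simg_compact (hNP t)).isClosed)
  obtain ⟨p, hp⟩ := hne
  refine ⟨p, Set.Subset.antisymm (fun y hy => ?_) (Set.singleton_subset_iff.2 hp)⟩
  rw [Set.mem_singleton_iff]
  obtain ⟨sw, hsw⟩ := reduce e A0 A1 hA a
  obtain ⟨x, q, hR, hcol⟩ := col_rec hn sw
  funext i
  have hR2 := hR.map (op' := fun a b => a + b)
    (fun v : Fin (n + 1) → ℝ => ((v i, ∑ k, v k) : ℝ × ℝ)) (by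
      intro a b
      simp only [Pi.add_apply, Finset.sum_add_distrib, Prod.mk_add_mk])
  have h0 : Al n x q 0 (fun v => ∑ k, v k = 1 ∧ 0 ≤ v i ∧ v i ≤ 1) := by
    rw [hcol]
    intro j
    simp only [List.range_zero, List.map_nil, wordProd, List.prod_nil, Matrix.one_apply]
    refine ⟨by simp, ?_, ?_⟩ <;> split <;> norm_num
  refine eq_of_forall_dist_le (fun ε hε => ?_)
  obtain ⟨t, α, ht⟩ := osc_small hn hR2 h0 ε hε
  have ht' : Al n x q t (fun v => α * (∑ k, v k) ≤ v i ∧ v i ≤ (α + ε) * (∑ k, v k)) := ht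
  rw [hcol] at ht'
  obtain ⟨b, hb⟩ := hsw t
  have hb' : P t = _ := hb
  have hall : ∀ j, α * (∑ k, (P t k j : ℝ)) ≤ P t i j ∧
      (P t i j : ℝ) ≤ (α + ε) * (∑ k, (P t k j : ℝ)) := by
    intro j
    rw [hb']
    cases b
    · simpa [Fe] using ht' j
    · simp only [Fe, cond_true, mul_F]
      exact ht' _
  have e1 := simg_bound (hNP t) i α ε hall y (Set.mem_iInter.1 hy t)
  have e2 := simg_bound (hNP t) i α ε hall p (Set.mem_iInter.1 hp t)
  rw [Real.dist_eq, abs_le]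
  constructor <;> linarith [e1.1, e1.2, e2.1, e2.2]

end Mk

theorem stmt3 (n : ℕ) (hn : 1 ≤ n) (A0 A1 : MatZ n)
    (h : (A0, A1) = (Mon0 n, Mon1 n) ∨ (A0, A1) = (Mon0 n, Mon1 n * Fmat n) ∨
         (A0, A1) = (Mon0 n * Fmat n, Mon1 n)) :
    Contractive A0 A1 := by
  rcases h with h | h | h <;> obtain ⟨rfl, rfl⟩ := Prod.mk.inj h
  · exact Mk.main hn (fun _ => false) _ _ (fun b => by cases b <;> simp [Mk.Mb, Mk.Fe])
  · exact Mk.main hn (fun b => b) _ _ (fun b => by cases b <;> simp [Mk.Mb, Mk.Fe])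
  · exact Mk.main hn (fun b => !b) _ _ (fun b => by cases b <;> simp [Mk.Mb, Mk.Fe])
end

section
/- Let P_0, P_1 be permutation matrices in S_{n+1} such that the pair (A_0, A_1) = (NP_0, LP_1) is topologically contractive. Then (A_0, A_1) is equivalent, under the action of S_2 × S_{n−1}, to one of the three pairs (M_0, M_1), (M_0, M_1F), (M_0F, M_1): there exists a permutation matrix H fixing both e_0 and e_1 such that either (HA_0H^{−1}, HA_1H^{−1}) or (FHA_1H^{−1}F, FHA_0H^{−1}F) equals one of these three pairs. -/
open Matrix

def InThree (n : ℕ) (B0 B1 : MatZ n) : Prop :=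
  (B0, B1) = (Mon0 n, Mon1 n) ∨ (B0, B1) = (Mon0 n, Mon1 n * Fmat n) ∨
  (B0, B1) = (Mon0 n * Fmat n, Mon1 n)

def Nn {n : ℕ} (A : MatZ n) : Prop := (∀ i j, 0 ≤ A i j) ∧ ∀ j, ∃ i, 1 ≤ A i j

lemma Nn.mul {n : ℕ} {A B : MatZ n} (hA : Nn A) (hB : Nn B) : Nn (A * B) := by
  refine ⟨fun i j => ?_, fun j => ?_⟩
  · rw [Matrix.mul_apply]
    exact Finset.sum_nonneg fun k _ => mul_nonneg (hA.1 _ _) (hB.1 _ _)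
  · obtain ⟨k, hk⟩ := hB.2 j
    obtain ⟨i, hi⟩ := hA.2 k
    refine ⟨i, ?_⟩
    rw [Matrix.mul_apply]
    calc (1:ℤ) ≤ A i k * B k j := by nlinarith
      _ ≤ _ := Finset.single_le_sum (f := fun k => A i k * B k j)
          (fun k _ => mul_nonneg (hA.1 _ _) (hB.1 _ _)) (Finset.mem_univ k)

lemma Nn.one {n : ℕ} : Nn (1 : MatZ n) := by
  refine ⟨fun i j => ?_, fun j => ⟨j, by simp⟩⟩
  rw [Matrix.one_apply]; split_ifs <;> simp

lemma mul_ge {n : ℕ} {A B : MatZ n} (hA : Nn A) (hB : Nn B) {i k j}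
    (h1 : 1 ≤ A i k) (h2 : 1 ≤ B k j) : 1 ≤ (A * B) i j := by
  rw [Matrix.mul_apply]
  calc (1:ℤ) ≤ A i k * B k j := by nlinarith
    _ ≤ _ := Finset.single_le_sum (f := fun k => A i k * B k j)
        (fun k _ => mul_nonneg (hA.1 _ _) (hB.1 _ _)) (Finset.mem_univ k)

def Lt {n : ℕ} (A0 A1 : MatZ n) (b : Bool) : MatZ n := bif b then A1 else A0

lemma Nn.Lt {n : ℕ} {A0 A1 : MatZ n} (h0 : Nn A0) (h1 : Nn A1) (b : Bool) : Nn (Lt A0 A1 b) := by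
  cases b <;> simpa [_root_.Lt]

lemma wp_nil {n : ℕ} (A0 A1 : MatZ n) : wordProd A0 A1 [] = 1 := by simp [wordProd]

lemma wp_cons {n : ℕ} (A0 A1 : MatZ n) (b) (w) :
    wordProd A0 A1 (b :: w) = Lt A0 A1 b * wordProd A0 A1 w := by simp [wordProd, Lt]

lemma wp_append {n : ℕ} (A0 A1 : MatZ n) (v w) :
    wordProd A0 A1 (v ++ w) = wordProd A0 A1 v * wordProd A0 A1 w := by simp [wordProd]

lemma wp_nn {n : ℕ} {A0 A1 : MatZ n} (h0 : Nn A0) (h1 : Nn A1) (w) : Nn (wordProd A0 A1 w) := by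
  induction w with
  | nil => rw [wp_nil]; exact Nn.one
  | cons b w ih => rw [wp_cons]; exact (h0.Lt h1 b).mul ih

def Wt {n : ℕ} (A0 A1 : MatZ n) (a : ℕ → Bool) (t : ℕ) : MatZ n :=
  wordProd A0 A1 ((List.range t).map a)

lemma Wt_zero {n : ℕ} (A0 A1 : MatZ n) (a) : Wt A0 A1 a 0 = 1 := by simp [Wt, wordProd]

lemma Wt_succ {n : ℕ} (A0 A1 : MatZ n) (a) (t) :
    Wt A0 A1 a (t+1) = Wt A0 A1 a t * Lt A0 A1 (a t) := by
  simp [Wt, wordProd, List.range_succ, Lt]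

lemma toR_mul {n : ℕ} (A B : MatZ n) : toR (A * B) = toR A * toR B := by
  simp only [toR]
  exact Matrix.map_mul (f := Int.castRingHom ℝ)

lemma Nn.sum_ge {n : ℕ} {A : MatZ n} (hA : Nn A) {x : Fin (n+1) → ℝ} (hx : ∀ i, 0 ≤ x i) :
    ∑ i, x i ≤ ∑ i, (toR A *ᵥ x) i := by
  have : ∑ i, (toR A *ᵥ x) i = ∑ j, (∑ i, (A i j : ℝ)) * x j := by
    simp only [Matrix.mulVec, dotProduct, toR, Matrix.map_apply]
    rw [Finset.sum_comm]
    simp [Finset.sum_mul]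
  rw [this]
  refine Finset.sum_le_sum fun j _ => ?_
  obtain ⟨i, hi⟩ := hA.2 j
  have h1 : (1:ℝ) ≤ ∑ i, (A i j : ℝ) := by
    calc (1:ℝ) ≤ A i j := by exact_mod_cast hi
      _ ≤ _ := Finset.single_le_sum (f := fun i => (A i j : ℝ))
        (fun k _ => by exact_mod_cast hA.1 _ _) (Finset.mem_univ i)
  nlinarith [hx j]

lemma Nn.mulVec_nonneg {n : ℕ} {A : MatZ n} (hA : Nn A) {x : Fin (n+1) → ℝ} (hx : ∀ i, 0 ≤ x i) (i) :
    0 ≤ (toR A *ᵥ x) i := by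
  simp only [Matrix.mulVec, dotProduct, toR, Matrix.map_apply]
  exact Finset.sum_nonneg fun j _ => mul_nonneg (by exact_mod_cast hA.1 _ _) (hx j)

lemma projAct_mem {n : ℕ} {A : MatZ n} (hA : Nn A) {x : Fin (n+1) → ℝ}
    (hx : x ∈ stdSimplex ℝ (Fin (n+1))) : projAct (toR A) x ∈ stdSimplex ℝ (Fin (n+1)) := by
  have h1 := hA.sum_ge hx.1
  rw [hx.2] at h1
  refine ⟨fun i => ?_, ?_⟩
  · simp only [projAct, Pi.smul_apply, smul_eq_mul]
    exact mul_nonneg (inv_nonneg.2 (by linarith)) (hA.mulVec_nonneg hx.1 i)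
  · simp only [projAct, Pi.smul_apply, smul_eq_mul, ← Finset.mul_sum]
    exact inv_mul_cancel₀ (by linarith)

lemma projAct_mul {n : ℕ} {A B : MatZ n} (hB : Nn B) {x : Fin (n+1) → ℝ}
    (hx : x ∈ stdSimplex ℝ (Fin (n+1))) :
    projAct (toR (A * B)) x = projAct (toR A) (projAct (toR B) x) := by
  have h1 := hB.sum_ge hx.1
  rw [hx.2] at h1
  simp only [projAct, toR_mul, ← Matrix.mulVec_mulVec, Matrix.mulVec_smul, Pi.smul_apply,
    smul_eq_mul, ← Finset.mul_sum, smul_smul, mul_inv, inv_inv]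
  congr 1
  field_simp

lemma simg_mul {n : ℕ} {A B : MatZ n} (hB : Nn B) : simg (A * B) ⊆ simg A := by
  rintro _ ⟨x, hx, rfl⟩
  exact ⟨_, projAct_mem hB hx, (projAct_mul hB hx).symm⟩

lemma simg_compact {n : ℕ} {A : MatZ n} (hA : Nn A) : IsCompact (simg A) := by
  refine (isCompact_stdSimplex ℝ (Fin (n+1))).image_of_continuousOn ?_
  have hc : Continuous fun x : Fin (n+1) → ℝ => toR A *ᵥ x := by
    exact Continuous.matrix_mulVec continuous_const continuous_id
  have hs : Continuous fun x : Fin (n+1) → ℝ => ∑ i, (toR A *ᵥ x) i :=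
    continuous_finsetSum _ fun i _ => (continuous_apply i).comp hc
  refine ContinuousOn.smul (ContinuousOn.inv₀ hs.continuousOn fun x hx => ?_) hc.continuousOn
  have h1 := hA.sum_ge hx.1
  rw [hx.2] at h1
  linarith

lemma Lim {n : ℕ} {A0 A1 : MatZ n} (h0 : Nn A0) (h1 : Nn A1) (hC : Contractive A0 A1)
    (a : ℕ → Bool) : ∃ p : Fin (n+1) → ℝ, ∀ ε > 0, ∃ T, ∀ t ≥ T, ∀ y ∈ simg (Wt A0 A1 a t),
      ∀ i, |y i - p i| < ε := by
  obtain ⟨p, hp⟩ := hC a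
  refine ⟨p, fun ε hε => ?_⟩
  have hanti : Antitone fun t => simg (Wt A0 A1 a t) := by
    refine antitone_nat_of_succ_le fun t => ?_
    rw [Wt_succ]
    exact simg_mul (h0.Lt h1 _)
  have hcp : ∀ t, IsCompact (simg (Wt A0 A1 a t)) := fun t => simg_compact (wp_nn h0 h1 _)
  obtain ⟨T, hT⟩ := exists_subset_nhds_of_isCompact' (V := fun t => simg (Wt A0 A1 a t))
    hanti.directed_ge hcp (fun t => (hcp t).isClosed) (U := Metric.ball p ε) (by
      intro x hx
      have : x ∈ ({p} : Set _) := hp ▸ hx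
      rw [Set.mem_singleton_iff.1 this]
      exact Metric.ball_mem_nhds _ hε)
  refine ⟨T, fun t ht y hy i => ?_⟩
  have := hT (hanti ht hy)
  rw [Metric.mem_ball] at this
  exact lt_of_le_of_lt (dist_le_pi_dist y p i) this

/-- normalized column -/
noncomputable def ncol {n : ℕ} (A : MatZ n) (j : Fin (n+1)) : Fin (n+1) → ℝ :=
  fun i => (∑ i, (A i j : ℝ))⁻¹ * A i j

lemma ncol_mem {n : ℕ} (A : MatZ n) (j : Fin (n+1)) : ncol A j ∈ simg A := by
  refine ⟨Pi.single j 1, single_mem_stdSimplex ℝ j, ?_⟩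
  funext i
  simp [projAct, ncol, toR]

lemma ncol_sum {n : ℕ} {A : MatZ n} (hA : Nn A) (j : Fin (n+1)) : ∑ i, ncol A j i = 1 := by
  obtain ⟨x, hx, e⟩ := ncol_mem A j
  rw [← e]; exact (projAct_mem hA hx).2

lemma IJ {n : ℕ} {A0 A1 : MatZ n} (h0 : Nn A0) (h1 : Nn A1) (hC : Contractive A0 A1)
    (a : ℕ → Bool) (I : ℕ → Fin (n+1) → Prop)
    (hI : ∀ t i j, Lt A0 A1 (a t) i j ≠ 0 → (I t i ↔ I (t+1) j))
    (hn1 : ∀ t, ∃ j, I t j) (hn2 : ∀ t, ∃ j, ¬ I t j) : False := by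
  have hW : ∀ t i j, Wt A0 A1 a t i j ≠ 0 → (I 0 i ↔ I t j) := by
    intro t
    induction t with
    | zero =>
      intro i j h
      rw [Wt_zero, Matrix.one_apply] at h
      have : i = j := by by_contra hh; simp [hh] at h
      rw [this]
    | succ t ih =>
      intro i j h
      rw [Wt_succ, Matrix.mul_apply] at h
      obtain ⟨k, -, hk⟩ := Finset.exists_ne_zero_of_sum_ne_zero h
      rw [ih i k (left_ne_zero_of_mul hk), hI t k j (right_ne_zero_of_mul hk)]
  obtain ⟨p, hp⟩ := Lim h0 h1 hC a
  set ε : ℝ := 1 / (2 * (n+1)) with hε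
  obtain ⟨T, hT⟩ := hp ε (by positivity)
  obtain ⟨j, hj⟩ := hn1 T
  obtain ⟨j', hj'⟩ := hn2 T
  set M := Wt A0 A1 a T with hM
  have hMn : Nn M := wp_nn h0 h1 _
  have e1 := hT T le_rfl _ (ncol_mem M j)
  have e2 := hT T le_rfl _ (ncol_mem M j')
  have key : ∀ i, ncol M j i < 2 * ε := by
    intro i
    have hpi : |p i| < ε := by
      by_cases hi : I 0 i
      · have : M i j' = 0 := by
          by_contra hh; exact hj' ((hW T i j' hh).1 hi)
        have h2 := e2 i
        simp only [ncol, this, Int.cast_zero, mul_zero, zero_sub, abs_neg] at h2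
        exact h2
      · have : M i j = 0 := by
          by_contra hh; exact hi ((hW T i j hh).2 hj)
        have h2 := e1 i
        simp only [ncol, this, Int.cast_zero, mul_zero, zero_sub, abs_neg] at h2
        exact h2
    have := e1 i
    rw [abs_lt] at *
    linarith
  have := Finset.sum_lt_sum_of_nonempty (s := Finset.univ) Finset.univ_nonempty
    (fun i _ => key i)
  rw [ncol_sum hMn] at this
  simp at this
  rw [hε] at this
  have e : (n + 1 : ℝ) * (2 * (1 / (2 * (n + 1)))) = 1 := by field_simp
  linarith

lemma Wt_periodic {n : ℕ} (A0 A1 : MatZ n) (w : List Bool) (hw : w ≠ []) (r : ℕ) :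
    Wt A0 A1 (fun t => w[t % w.length]!) (r * w.length) = wordProd A0 A1 w ^ r := by
  have hl : 0 < w.length := List.length_pos_iff.2 hw
  induction r with
  | zero => simp [Wt_zero]
  | succ r ih =>
    rw [pow_succ, ← ih]
    simp only [Wt]
    rw [← wp_append]
    congr 1
    rw [Nat.succ_mul, List.range_add, List.map_append]
    congr 1
    apply List.ext_getElem
    · simp
    · intro i h1 h2
      simp at h1
      simp [Nat.mod_eq_of_lt h1, h1]

lemma growth {n : ℕ} {A0 A1 : MatZ n} (h0 : Nn A0) (h1 : Nn A1) (hC : Contractive A0 A1)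
    (w : List Bool) (k x y : Fin (n+1)) (hxk : x ≠ k) (hyk : y ≠ k) (hxy : x ≠ y)
    (hk : ∀ i, wordProd A0 A1 w i k = if i = k then 1 else 0)
    (hxx : 1 ≤ wordProd A0 A1 w x x) (hxy' : 1 ≤ wordProd A0 A1 w x y)
    (hyx : 1 ≤ wordProd A0 A1 w y x) (hyy : 1 ≤ wordProd A0 A1 w y y) : False := by
  have hw : w ≠ [] := by
    rintro rfl
    rw [wp_nil, Matrix.one_apply_ne hxy] at hxy'
    omega
  have hl : 0 < w.length := List.length_pos_iff.2 hw
  set U := wordProd A0 A1 w with hU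
  have hUn : Nn U := wp_nn h0 h1 _
  have hUp : ∀ r, Nn (U ^ r) := by
    intro r; induction r with
    | zero => simpa using Nn.one
    | succ r ih => rw [pow_succ]; exact ih.mul hUn
  obtain ⟨p, hp⟩ := Lim h0 h1 hC (fun t => w[t % w.length]!)
  have hp' : ∀ ε > 0, ∃ T, ∀ r ≥ T, ∀ j i, |ncol (U ^ r) j i - p i| < ε := by
    intro ε hε
    obtain ⟨T, hT⟩ := hp ε hε
    refine ⟨T, fun r hr j i => hT (r * w.length) (by nlinarith) _ ?_ i⟩
    rw [Wt_periodic A0 A1 w hw]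
    exact ncol_mem _ _
  have hUk : ∀ r i, (U ^ r) i k = if i = k then 1 else 0 := by
    intro r; induction r with
    | zero => intro i; simp [Matrix.one_apply]
    | succ r ih =>
      intro i
      rw [pow_succ, Matrix.mul_apply]
      simp [hk, ih]
  have hpk : p k = 1 := by
    by_contra hne
    obtain ⟨T, hT⟩ := hp' |1 - p k| (abs_pos.2 (sub_ne_zero.2 (Ne.symm hne)))
    have := hT T le_rfl k k
    simp [ncol, hUk] at this
  -- sequences
  set u : ℕ → Fin (n+1) → ℝ := fun r i => ((U ^ r) i x : ℝ) with hu
  have hu0 : ∀ r i, 0 ≤ u r i := fun r i => by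
    simp only [hu]; exact_mod_cast (hUp r).1 i x
  have hus : ∀ r i, u (r+1) i = ∑ j, (U i j : ℝ) * u r j := by
    intro r i
    simp only [hu, pow_succ', Matrix.mul_apply]
    push_cast; rfl
  have hU0 : ∀ i j, (0:ℝ) ≤ U i j := fun i j => by exact_mod_cast hUn.1 i j
  set s : ℕ → ℝ := fun r => ∑ i ∈ Finset.univ.erase k, u r i with hs
  have hsum : ∀ r, ∑ i, u r i = u r k + s r := fun r =>
    (Finset.add_sum_erase _ _ (Finset.mem_univ k)).symm
  have hs0 : ∀ r, 0 ≤ s r := fun r => Finset.sum_nonneg fun i _ => hu0 r i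
  have hxyU : ∀ r i, (1:ℤ) ≤ U i x → 1 ≤ U i y → u r x + u r y ≤ u (r+1) i := by
    intro r i e1 e2
    rw [hus]
    have e1' : (1:ℝ) ≤ U i x := by exact_mod_cast e1
    have e2' : (1:ℝ) ≤ U i y := by exact_mod_cast e2
    calc u r x + u r y ≤ (U i x : ℝ) * u r x + U i y * u r y := by nlinarith [hu0 r x, hu0 r y]
      _ = ∑ j ∈ {x, y}, (U i j : ℝ) * u r j := by rw [Finset.sum_pair hxy]
      _ ≤ _ := Finset.sum_le_sum_of_subset_of_nonneg (Finset.subset_univ _)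
          fun j _ _ => mul_nonneg (hU0 _ _) (hu0 _ _)
  have hgrow : ∀ r, (2:ℝ) ^ r ≤ u r x + u r y := by
    intro r
    induction r with
    | zero => simp [hu, hxy.symm]
    | succ r ih =>
      have := hxyU r x hxx hxy'
      have := hxyU r y hyx hyy
      rw [pow_succ]; linarith
  have hgs : ∀ r, (2:ℝ) ^ r ≤ s r := by
    intro r
    refine (hgrow r).trans ?_
    calc u r x + u r y = ∑ j ∈ {x, y}, u r j := by rw [Finset.sum_pair hxy]
      _ ≤ _ := Finset.sum_le_sum_of_subset_of_nonneg
        (by intro i; simp; rintro (rfl | rfl) <;> assumption) fun j _ _ => hu0 _ _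
  set c : ℝ := ∑ j, (U k j : ℝ) with hc
  have hc0 : 0 ≤ c := Finset.sum_nonneg fun j _ => hU0 _ _
  have hv : ∀ r, u (r+1) k ≤ u r k + c * s r := by
    intro r
    rw [hus, ← Finset.add_sum_erase _ _ (Finset.mem_univ k)]
    have : (U k k : ℝ) = 1 := by rw [hk]; simp
    rw [this, one_mul]
    gcongr
    simp only [hs, Finset.mul_sum]
    refine Finset.sum_le_sum fun j _ => ?_
    gcongr
    · exact hu0 _ _
    · exact Finset.single_le_sum (f := fun j => (U k j : ℝ)) (fun j _ => hU0 k j) (Finset.mem_univ j)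
  set ε : ℝ := 1 / (2 * (c + 1) + 1) with hε
  have hεp : 0 < ε := by positivity
  obtain ⟨T, hT⟩ := hp' ε hεp
  have hsv : ∀ r ≥ T, 2 * (c + 1) * s r ≤ u r k := by
    intro r hr
    have := hT r hr x k
    rw [hpk] at this
    have h3 : (∑ i, ((U ^ r) i x : ℝ)) = u r k + s r := hsum r
    simp only [ncol, h3] at this
    have hpos : 0 < u r k + s r := by
      have := hgs r; have := hu0 r k; have : (0:ℝ) < 2 ^ r := by positivity
      linarith
    have h4 : (((U ^ r) k x : ℤ) : ℝ) = u r k := rfl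
    rw [h4, abs_lt] at this
    have h5 : (u r k + s r)⁻¹ * u r k = 1 - s r / (u r k + s r) := by field_simp; ring
    rw [h5] at this
    have h6 : s r / (u r k + s r) < 1 / (2 * (c + 1) + 1) := by linarith [this.1]
    rw [div_lt_div_iff₀ hpos (by positivity)] at h6
    linarith
  have hdec : ∀ r, u (T + r) k ≤ u T k * (3/2) ^ r := by
    intro r
    induction r with
    | zero => simp
    | succ r ih =>
      have e1 := hv (T + r)
      have e2 := hsv (T + r) (by omega)
      have e3 := hs0 (T + r)
      rw [← add_assoc, pow_succ]
      nlinarith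
  have hfin : ∀ r : ℕ, (4/3 : ℝ) ^ r ≤ u T k := by
    intro r
    have e1 := hdec r
    have e2 := hsv (T + r) (by omega)
    have e3 := hgs (T + r)
    have e4 := hs0 (T + r)
    have e5 : (2:ℝ) ^ r ≤ 2 ^ (T + r) := pow_le_pow_right₀ (by norm_num) (by omega)
    have e6 : (2:ℝ) ^ r ≤ u T k * (3/2) ^ r := by nlinarith
    have e7 : (2:ℝ) ^ r = (4/3) ^ r * (3/2) ^ r := by rw [← mul_pow]; norm_num
    rw [e7] at e6
    exact le_of_mul_le_mul_right e6 (by positivity)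
  obtain ⟨r, hr⟩ := pow_unbounded_of_one_lt (u T k) (show (1:ℝ) < 4/3 by norm_num)
  linarith [hfin r]

def Cm {n : ℕ} (z o : Fin (n+1)) (q : Equiv.Perm (Fin (n+1))) : MatZ n :=
  Matrix.of fun i j => (if q i = j then 1 else 0) + (if i = z ∧ q o = j then 1 else 0)

lemma Cm_nn {n : ℕ} (z o : Fin (n+1)) (q) : Nn (Cm z o q) := by
  refine ⟨fun i j => ?_, fun j => ⟨q.symm j, ?_⟩⟩
  · simp only [Cm, Matrix.of_apply]; split_ifs <;> simp
  · simp only [Cm, Matrix.of_apply]; split_ifs <;> simp_all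

lemma permMat_mul {n : ℕ} (σ : Equiv.Perm (Fin (n+1))) (A : MatZ n) (i j) :
    (permMat σ * A) i j = A (σ⁻¹ i) j := by
  rw [Matrix.mul_apply]
  have : ∀ k, permMat σ i k = if σ⁻¹ i = k then 1 else 0 := by
    intro k
    simp only [permMat, Matrix.of_apply, Equiv.Perm.inv_eq_iff_eq]
  simp [this]

lemma mul_permMat {n : ℕ} (σ : Equiv.Perm (Fin (n+1))) (A : MatZ n) (i j) :
    (A * permMat σ) i j = A i (σ j) := by
  rw [Matrix.mul_apply]
  simp [permMat]

lemma permMat_permMat {n : ℕ} (σ τ : Equiv.Perm (Fin (n+1))) :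
    permMat σ * permMat τ = permMat (σ * τ) := by
  ext i j
  rw [mul_permMat]; rfl

lemma conj_Cm {n : ℕ} (σ : Equiv.Perm (Fin (n+1))) (z o q) :
    permMat σ * Cm z o q * permMat σ⁻¹ = Cm (σ z) (σ o) (σ * q * σ⁻¹) := by
  ext i j
  rw [mul_permMat, permMat_mul]
  have e1 : q (σ⁻¹ i) = σ⁻¹ j ↔ (σ * q * σ⁻¹) i = j := by
    rw [Equiv.Perm.eq_inv_iff_eq]; rfl
  have e2 : (σ⁻¹ i = z ∧ q o = σ⁻¹ j) ↔ (i = σ z ∧ (σ * q * σ⁻¹) (σ o) = j) := by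
    rw [Equiv.Perm.eq_inv_iff_eq, Equiv.Perm.inv_eq_iff_eq]
    simp
  simp only [Cm, Matrix.of_apply]
  exact congrArg₂ _ (if_congr e1 rfl rfl) (if_congr e2 rfl rfl)

lemma Cm_mul_permMat {n : ℕ} (σ : Equiv.Perm (Fin (n+1))) (z o q) :
    Cm z o q * permMat σ = Cm z o (σ⁻¹ * q) := by
  ext i j
  rw [mul_permMat]
  simp only [Cm, Matrix.of_apply, Equiv.Perm.mul_apply, Equiv.Perm.inv_eq_iff_eq]

lemma Nmat_eq {n : ℕ} (hn : 1 ≤ n) : Nmat n = Cm 0 1 1 := by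
  obtain ⟨m, rfl⟩ : ∃ m, n = m + 1 := ⟨n - 1, by omega⟩
  ext i j
  simp only [Nmat, Cm, Matrix.of_apply, Equiv.Perm.one_apply]
  by_cases h : i = j
  · subst h
    have : ¬ (i = 0 ∧ 1 = i) := by rintro ⟨rfl, h⟩; simp at h
    simp [this]
  · simp [h, and_comm, eq_comm]

lemma Fmat_eq (n : ℕ) : Fmat n = permMat (Equiv.swap 0 1) := rfl

lemma Lmat_eq {n : ℕ} (hn : 1 ≤ n) : Lmat n = Cm 1 0 1 := by
  have := conj_Cm (n := n) (Equiv.swap 0 1) 0 1 1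
  rw [Equiv.swap_inv] at this
  simp only [Lmat, Nmat_eq hn, Fmat_eq, this]
  simp

def rot (n : ℕ) : Equiv.Perm (Fin (n+1)) := Equiv.addRight 1

lemma Rmat_eq (n : ℕ) : Rmat n = permMat (rot n) := rfl

lemma isPerm_eq {n : ℕ} {P : MatZ n} (h : IsPermMat P) : ∃ σ, P = permMat σ := by
  obtain ⟨σ, h⟩ := h
  exact ⟨σ, by ext i j; rw [h]; rfl⟩

lemma wp_conj {n : ℕ} (σ : Equiv.Perm (Fin (n+1))) (A0 A1 : MatZ n) (w) :
    wordProd (permMat σ * A0 * permMat σ⁻¹) (permMat σ * A1 * permMat σ⁻¹) w =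
      permMat σ * wordProd A0 A1 w * permMat σ⁻¹ := by
  have h1 : permMat (1 : Equiv.Perm (Fin (n+1))) = 1 := by
    ext i j; rw [Matrix.one_apply]; rfl
  induction w with
  | nil => rw [wp_nil, wp_nil, mul_one, permMat_permMat]; simp [h1]
  | cons b w ih =>
    rw [wp_cons, wp_cons, ih]
    have : permMat σ⁻¹ * permMat σ = 1 := by rw [permMat_permMat]; simp [h1]
    have e : Lt (permMat σ * A0 * permMat σ⁻¹) (permMat σ * A1 * permMat σ⁻¹) b =
      permMat σ * Lt A0 A1 b * permMat σ⁻¹ := by cases b <;> rfl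
    rw [e]
    calc _ = permMat σ * Lt A0 A1 b * (permMat σ⁻¹ * permMat σ) * wordProd A0 A1 w * permMat σ⁻¹ := by
            simp only [mul_assoc]
      _ = _ := by rw [this]; simp only [mul_assoc, one_mul]

lemma projAct_conj {n : ℕ} (σ : Equiv.Perm (Fin (n+1))) (A : MatZ n) (x : Fin (n+1) → ℝ) :
    projAct (toR (permMat σ * A * permMat σ⁻¹)) x = projAct (toR A) (x ∘ σ) ∘ σ.symm := by
  have h : ∀ i, (toR (permMat σ * A * permMat σ⁻¹) *ᵥ x) i = (toR A *ᵥ (x ∘ σ)) (σ.symm i) := by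
    intro i
    simp only [Matrix.mulVec, dotProduct, toR, Matrix.map_apply, mul_permMat, permMat_mul]
    rw [← Equiv.sum_comp σ]
    simp
  funext i
  simp only [projAct, Function.comp, Pi.smul_apply, h]
  rw [Equiv.sum_comp σ.symm (fun i => (toR A *ᵥ (x ∘ σ)) i)]

lemma simg_conj {n : ℕ} (σ : Equiv.Perm (Fin (n+1))) (A : MatZ n) :
    simg (permMat σ * A * permMat σ⁻¹) = (fun x => x ∘ σ.symm) '' simg A := by
  have hm : ∀ (τ : Equiv.Perm (Fin (n+1))) (x), x ∈ stdSimplex ℝ (Fin (n+1)) →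
      x ∘ τ ∈ stdSimplex ℝ (Fin (n+1)) := by
    intro τ x hx
    exact ⟨fun i => hx.1 _, by rw [← hx.2]; exact Equiv.sum_comp τ x⟩
  ext y
  constructor
  · rintro ⟨x, hx, rfl⟩
    exact ⟨_, ⟨_, hm σ x hx, rfl⟩, (projAct_conj σ A x).symm⟩
  · rintro ⟨_, ⟨x, hx, rfl⟩, rfl⟩
    refine ⟨x ∘ σ.symm, hm _ x hx, ?_⟩
    rw [projAct_conj]
    congr 2
    funext i; simp

lemma Contractive.conj {n : ℕ} {A0 A1 : MatZ n} (hC : Contractive A0 A1)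
    (σ : Equiv.Perm (Fin (n+1))) :
    Contractive (permMat σ * A0 * permMat σ⁻¹) (permMat σ * A1 * permMat σ⁻¹) := by
  intro a
  obtain ⟨p, hp⟩ := hC a
  refine ⟨p ∘ σ.symm, ?_⟩
  simp only [wp_conj, simg_conj]
  rw [← Set.image_iInter (f := fun x : Fin (n+1) → ℝ => x ∘ σ.symm), hp, Set.image_singleton]
  exact (Equiv.arrowCongr σ (Equiv.refl ℝ)).bijective

lemma Contractive.swap {n : ℕ} {A0 A1 : MatZ n} (hC : Contractive A0 A1) : Contractive A1 A0 := by
  intro a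
  obtain ⟨p, hp⟩ := hC (fun t => !a t)
  refine ⟨p, ?_⟩
  rw [← hp]
  congr 1
  funext t
  congr 1
  simp only [wordProd, List.map_map]
  congr 2
  funext b
  simp

def Ctr {n : ℕ} (z o : Fin (n+1)) (q0 q1 : Equiv.Perm (Fin (n+1))) : Prop :=
  Contractive (Cm z o q0) (Cm o z q1)

lemma Ctr.conj {n : ℕ} {z o : Fin (n+1)} {q0 q1} (h : Ctr z o q0 q1) (σ : Equiv.Perm (Fin (n+1))) :
    Ctr (σ z) (σ o) (σ * q0 * σ⁻¹) (σ * q1 * σ⁻¹) := by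
  have := Contractive.conj h σ
  rwa [conj_Cm, conj_Cm] at this

lemma Ctr.swap {n : ℕ} {z o : Fin (n+1)} {q0 q1} (h : Ctr z o q0 q1) : Ctr o z q1 q0 :=
  Contractive.swap h

/-- the permutation used at a letter -/
def qq {n : ℕ} (q0 q1 : Equiv.Perm (Fin (n+1))) (b : Bool) : Equiv.Perm (Fin (n+1)) :=
  bif b then q1 else q0

/-- the column killed at a letter -/
def ob {n : ℕ} (z o : Fin (n+1)) (b : Bool) : Fin (n+1) := bif b then z else o

lemma Lt_eq {n : ℕ} (z o : Fin (n+1)) (q0 q1) (b) :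
    Lt (Cm z o q0) (Cm o z q1) b = Cm (ob z o !b) (ob z o b) (qq q0 q1 b) := by
  cases b <;> rfl

lemma factS {n : ℕ} {z o : Fin (n+1)} {q0 q1} (h : Ctr z o q0 q1) (a : ℕ → Bool)
    (k : ℕ → Fin (n+1)) (hk : ∀ t, k t ≠ z ∧ k t ≠ o) (hs : ∀ t, k (t+1) = qq q0 q1 (a t) (k t)) :
    False := by
  refine IJ (Cm_nn _ _ _) (Cm_nn _ _ _) h a (fun t i => i = k t) ?_ (fun t => ⟨_, rfl⟩)
    (fun t => ⟨z, (hk t).1.symm⟩)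
  intro t i j hij
  have h1 := hk t
  simp only [hs]
  rw [Lt_eq] at hij
  simp only [Cm, Matrix.of_apply] at hij
  by_cases e : qq q0 q1 (a t) i = j
  · rw [← e]; simp
  · have e2 : i = ob z o (!a t) ∧ qq q0 q1 (a t) (ob z o (a t)) = j := by
      by_contra hh; simp [e, hh] at hij
    rw [← e2.2, e2.1]
    rw [(qq q0 q1 (a t)).injective.eq_iff]
    cases a t <;> simp [ob, h1.1.symm, h1.2.symm]

/-- surviving columns -/
def Pth {n : ℕ} (z o : Fin (n+1)) (q0 q1 : Equiv.Perm (Fin (n+1))) :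
    List Bool → Fin (n+1) → Fin (n+1) → Prop
  | [], k, l => k = l
  | b :: w, k, l => k ≠ ob z o b ∧ Pth z o q0 q1 w (qq q0 q1 b k) l

def qw {n : ℕ} (q0 q1 : Equiv.Perm (Fin (n+1))) : List Bool → Equiv.Perm (Fin (n+1))
  | [] => 1
  | b :: w => qw q0 q1 w * qq q0 q1 b

lemma Pth.append {n : ℕ} {z o : Fin (n+1)} {q0 q1} {v w} {k l r} (h1 : Pth z o q0 q1 v k l)
    (h2 : Pth z o q0 q1 w l r) : Pth z o q0 q1 (v ++ w) k r := by
  induction v generalizing k with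
  | nil => cases h1; exact h2
  | cons b v ih => exact ⟨h1.1, ih h1.2⟩

lemma qw_append {n : ℕ} (q0 q1 : Equiv.Perm (Fin (n+1))) (v w) :
    qw q0 q1 (v ++ w) = qw q0 q1 w * qw q0 q1 v := by
  induction v with
  | nil => simp [qw]
  | cons b v ih => simp [qw, ih, mul_assoc]

abbrev WW {n : ℕ} (z o : Fin (n+1)) (q0 q1 : Equiv.Perm (Fin (n+1))) (w : List Bool) : MatZ n :=
  wordProd (Cm z o q0) (Cm o z q1) w

lemma WW_nn {n : ℕ} (z o : Fin (n+1)) (q0 q1) (w) : Nn (WW z o q0 q1 w) :=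
  wp_nn (Cm_nn _ _ _) (Cm_nn _ _ _) w

lemma Pth.col {n : ℕ} {z o : Fin (n+1)} {q0 q1} {w} {k l} (h : Pth z o q0 q1 w k l) (i) :
    WW z o q0 q1 w i l = if i = k then 1 else 0 := by
  induction w generalizing k i with
  | nil => cases h; simp [WW, wp_nil, Matrix.one_apply]
  | cons b w ih =>
    simp only [WW, wp_cons, Matrix.mul_apply]
    have := ih h.2
    simp only [WW] at this
    simp only [this, Lt_eq]
    have hk : ob z o b ≠ k := h.1.symm
    simp [Cm, hk]

lemma WW_qw {n : ℕ} (z o : Fin (n+1)) (q0 q1) (w) (i) :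
    1 ≤ WW z o q0 q1 w i (qw q0 q1 w i) := by
  induction w generalizing i with
  | nil => simp [WW, wp_nil, qw]
  | cons b w ih =>
    simp only [WW, wp_cons]
    refine mul_ge ((Cm_nn _ _ _).Lt (Cm_nn _ _ _) b) (WW_nn z o q0 q1 w) (k := qq q0 q1 b i) ?_ (ih _)
    rw [Lt_eq]
    simp only [Cm, Matrix.of_apply, if_true]
    split_ifs <;> simp

lemma WW_qw' {n : ℕ} (z o : Fin (n+1)) (q0 q1) (b) (w) :
    1 ≤ WW z o q0 q1 (b :: w) (ob z o !b) (qw q0 q1 (b :: w) (ob z o b)) := by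
  simp only [WW, wp_cons]
  refine mul_ge ((Cm_nn _ _ _).Lt (Cm_nn _ _ _) b) (WW_nn z o q0 q1 w)
    (k := qq q0 q1 b (ob z o b)) ?_ (WW_qw _ _ _ _ _ _)
  rw [Lt_eq]
  simp only [Cm, Matrix.of_apply]
  simp
  split_ifs <;> simp

/-- a loop at `k` starting with `b` gives one with trivial permutation part -/
lemma loop_pow {n : ℕ} {z o : Fin (n+1)} {q0 q1} {b w} {k} (h : Pth z o q0 q1 (b :: w) k k) :
    ∃ w', Pth z o q0 q1 (b :: w') k k ∧ qw q0 q1 (b :: w') = 1 := by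
  have key : ∀ r : ℕ, ∃ w', Pth z o q0 q1 (b :: w') k k ∧
      qw q0 q1 (b :: w') = qw q0 q1 (b :: w) ^ (r+1) := by
    intro r
    induction r with
    | zero => exact ⟨w, h, by simp⟩
    | succ r ih =>
      obtain ⟨w', h1, h2⟩ := ih
      refine ⟨w' ++ (b :: w), Pth.append (v := b :: w') h1 h, ?_⟩
      rw [← List.cons_append, qw_append, h2, ← pow_succ']
  obtain ⟨w', h1, h2⟩ := key (orderOf (qw q0 q1 (b :: w)) - 1)
  refine ⟨w', h1, ?_⟩
  rw [h2, Nat.sub_add_cancel (orderOf_pos _), pow_orderOf_eq_one]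

def Reach {n : ℕ} (z o : Fin (n+1)) (q0 q1 : Equiv.Perm (Fin (n+1))) (k l : Fin (n+1)) : Prop :=
  ∃ w, Pth z o q0 q1 w k l

lemma Reach.refl {n : ℕ} {z o : Fin (n+1)} {q0 q1} (k) : Reach z o q0 q1 k k := ⟨[], rfl⟩

lemma Reach.trans {n : ℕ} {z o : Fin (n+1)} {q0 q1} {k l r} (h1 : Reach z o q0 q1 k l)
    (h2 : Reach z o q0 q1 l r) : Reach z o q0 q1 k r := by
  obtain ⟨v, hv⟩ := h1
  obtain ⟨w, hw⟩ := h2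
  exact ⟨_, hv.append hw⟩

lemma Reach.s0 {n : ℕ} {z o : Fin (n+1)} {q0 q1} {k} (h : k ≠ o) : Reach z o q0 q1 k (q0 k) :=
  ⟨[false], h, rfl⟩

lemma Reach.s1 {n : ℕ} {z o : Fin (n+1)} {q0 q1} {k} (h : k ≠ z) : Reach z o q0 q1 k (q1 k) :=
  ⟨[true], h, rfl⟩

lemma factD {n : ℕ} {z o : Fin (n+1)} {q0 q1} (hzo : z ≠ o) (h : Ctr z o q0 q1)
    {k : Fin (n+1)} (hz : k ≠ z) (ho : k ≠ o) (h0 : Reach z o q0 q1 (q0 k) k)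
    (h1 : Reach z o q0 q1 (q1 k) k) : False := by
  obtain ⟨v, hv⟩ := h0
  obtain ⟨w, hw⟩ := h1
  obtain ⟨v, hv, ev⟩ := loop_pow (b := false) (w := v) (k := k) ⟨ho, hv⟩
  obtain ⟨w, hw, ew⟩ := loop_pow (b := true) (w := w) (k := k) ⟨hz, hw⟩
  have a1 : ∀ i, 1 ≤ WW z o q0 q1 (false :: v) i i := fun i => by
    have := WW_qw z o q0 q1 (false :: v) i; rwa [ev] at this
  have a2 : ∀ i, 1 ≤ WW z o q0 q1 (true :: w) i i := fun i => by
    have := WW_qw z o q0 q1 (true :: w) i; rwa [ew] at this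
  have b1 : 1 ≤ WW z o q0 q1 (false :: v) z o := by
    have := WW_qw' z o q0 q1 false v; rwa [ev] at this
  have b2 : 1 ≤ WW z o q0 q1 (true :: w) o z := by
    have := WW_qw' z o q0 q1 true w; rwa [ew] at this
  have n1 := WW_nn z o q0 q1 (false :: v)
  have n2 := WW_nn z o q0 q1 (true :: w)
  have e : WW z o q0 q1 ((false :: v) ++ (true :: w)) =
    WW z o q0 q1 (false :: v) * WW z o q0 q1 (true :: w) := wp_append _ _ _ _
  refine growth (Cm_nn _ _ _) (Cm_nn _ _ _) h ((false :: v) ++ (true :: w)) k z o hz.symm ho.symm hzo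
    (hv.append hw).col ?_ ?_ ?_ ?_
  · change 1 ≤ WW _ _ _ _ _ _ _
    rw [e]; exact mul_ge n1 n2 (a1 z) (a2 z)
  · change 1 ≤ WW _ _ _ _ _ _ _
    rw [e]; exact mul_ge n1 n2 b1 (a2 o)
  · change 1 ≤ WW _ _ _ _ _ _ _
    rw [e]; exact mul_ge n1 n2 (a1 o) b2
  · change 1 ≤ WW _ _ _ _ _ _ _
    rw [e]; exact mul_ge n1 n2 (a1 o) (a2 o)

open Classical in
lemma core0 {n : ℕ} {z o : Fin (n+1)} {q0 q1} (hzo : z ≠ o) (h : Ctr z o q0 q1) :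
    q0 z = z ∨ q1 o = o ∨ (q0 z = o ∧ q1 o = z) := by
  obtain ⟨x, -, hx⟩ := Finset.exists_min_image (Finset.univ : Finset (Fin (n+1)))
    (fun x => (Finset.univ.filter fun y => Reach z o q0 q1 x y).card) ⟨z, Finset.mem_univ _⟩
  have hback : ∀ y, Reach z o q0 q1 x y → Reach z o q0 q1 y x := by
    intro y hy
    have hsub : (Finset.univ.filter fun r => Reach z o q0 q1 y r) ⊆
        (Finset.univ.filter fun r => Reach z o q0 q1 x r) := by
      intro r; simp only [Finset.mem_filter, Finset.mem_univ, true_and]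
      exact fun hr => hy.trans hr
    have := Finset.eq_of_subset_of_card_le hsub (hx y (Finset.mem_univ _))
    have hm : x ∈ (Finset.univ.filter fun r => Reach z o q0 q1 x r) := by
      simp [Reach.refl]
    rw [← this] at hm
    simpa using hm
  have hzo' : ∀ y, Reach z o q0 q1 x y → y = z ∨ y = o := by
    intro y hy
    by_contra hh
    push Not at hh
    have r0 := hy.trans (Reach.s0 (z := z) (q0 := q0) (q1 := q1) hh.2)
    have r1 := hy.trans (Reach.s1 (o := o) (q0 := q0) (q1 := q1) hh.1)
    exact factD hzo h hh.1 hh.2 ((hback _ r0).trans hy) ((hback _ r1).trans hy)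
  have cz : Reach z o q0 q1 x z → q0 z = z ∨ (q0 z = o ∧ Reach z o q0 q1 x o) := by
    intro hr
    have := hr.trans (Reach.s0 (z := z) (q0 := q0) (q1 := q1) hzo)
    rcases hzo' _ this with e | e
    · exact Or.inl e
    · exact Or.inr ⟨e, e ▸ this⟩
  have co : Reach z o q0 q1 x o → q1 o = o ∨ (q1 o = z ∧ Reach z o q0 q1 x z) := by
    intro hr
    have := hr.trans (Reach.s1 (o := o) (q0 := q0) (q1 := q1) hzo.symm)
    rcases hzo' _ this with e | e
    · exact Or.inr ⟨e, e ▸ this⟩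
    · exact Or.inl e
  have : Reach z o q0 q1 x z ∨ Reach z o q0 q1 x o := by
    rcases hzo' x (Reach.refl x) with e | e
    · left; rw [← e]; exact Reach.refl x
    · right; rw [← e]; exact Reach.refl x
  tauto

lemma natfun {N : ℕ} (q : Equiv.Perm (Fin N)) : ∃ g : ℕ → ℕ, (∀ k : Fin N, (q k).val = g k.val) ∧
    (∀ k < N, g k < N) ∧ ∀ j < N, ∀ k < N, g j = g k → j = k := by
  refine ⟨fun k => if h : k < N then (q ⟨k, h⟩).val else k, ?_, ?_, ?_⟩
  · intro k; simp
  · intro k hk; simp [hk]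
  · intro j hj k hk h
    simp only [hj, hk, dif_pos] at h
    have := q.injective (Fin.ext h)
    simpa using this

lemma natA {N : ℕ} (hN : 0 < N) {g : ℕ → ℕ} (hb : ∀ k < N, g k < N)
    (hi : ∀ j < N, ∀ k < N, g j = g k → j = k) (h : ∀ k, 1 ≤ k → k < N → g k < k) :
    (∀ k, 1 ≤ k → k < N → g k + 1 = k) ∧ g 0 + 1 = N := by
  have h1 : ∀ k, 1 ≤ k → k < N → g k + 1 = k := by
    intro k
    induction k using Nat.strong_induction_on with
    | _ k ih =>
      intro k1 k2
      have := h k k1 k2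
      by_contra hne
      have e := ih (g k + 1) (by omega) (by omega) (by omega)
      have := hi (g k + 1) (by omega) k k2 (by omega)
      omega
  refine ⟨h1, ?_⟩
  have := hb 0 hN
  by_contra hne
  have e := h1 (g 0 + 1) (by omega) (by omega)
  have := hi (g 0 + 1) (by omega) 0 hN (by omega)
  omega

lemma natB {N : ℕ} (hN : 3 ≤ N) {g : ℕ → ℕ} (hb : ∀ k < N, g k < N)
    (hi : ∀ j < N, ∀ k < N, g j = g k → j = k) (h : ∀ k, 2 ≤ k → k < N → g k < k) (hg : g 1 = 1) :
    g 2 = 0 ∧ (∀ k, 3 ≤ k → k < N → g k + 1 = k) ∧ g 0 + 1 = N := by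
  have h2 : g 2 = 0 := by
    have := h 2 le_rfl (by omega)
    by_contra hne
    have := hi 2 (by omega) 1 (by omega) (by omega)
    omega
  have h1 : ∀ k, 3 ≤ k → k < N → g k + 1 = k := by
    intro k
    induction k using Nat.strong_induction_on with
    | _ k ih =>
      intro k1 k2
      have := h k (by omega) k2
      by_contra hne
      have a0 : g k ≠ 0 := fun e => by have := hi k k2 2 (by omega) (by omega); omega
      have a1 : g k ≠ 1 := fun e => by have := hi k k2 1 (by omega) (by omega); omega
      have e := ih (g k + 1) (by omega) (by omega) (by omega)
      have := hi (g k + 1) (by omega) k k2 (by omega)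
      omega
  refine ⟨h2, h1, ?_⟩
  have := hb 0 (by omega)
  by_contra hne
  have a0 : g 0 ≠ 0 := fun e => by have := hi 0 (by omega) 2 (by omega) (by omega); omega
  have a1 : g 0 ≠ 1 := fun e => by have := hi 0 (by omega) 1 (by omega) (by omega); omega
  have e := h1 (g 0 + 1) (by omega) (by omega)
  have := hi (g 0 + 1) (by omega) 0 (by omega) (by omega)
  omega

lemma natC {N : ℕ} (hN : 3 ≤ N) {g : ℕ → ℕ} (hb : ∀ k < N, g k < N)
    (hi : ∀ j < N, ∀ k < N, g j = g k → j = k) (h : ∀ k, 2 ≤ k → k < N → g k < k) (hg : g 1 = 2)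
    (h2 : g 2 = 0) :
    (3 < N → g 3 = 1) ∧ (∀ k, 4 ≤ k → k < N → g k + 1 = k) ∧ (3 < N → g 0 + 1 = N) ∧
      (N = 3 → g 0 = 1) := by
  have h3 : 3 < N → g 3 = 1 := by
    intro hN
    have := h 3 (by omega) (by omega)
    have a0 : g 3 ≠ 0 := fun e => by have := hi 3 (by omega) 2 (by omega) (by omega); omega
    have a1 : g 3 ≠ 2 := fun e => by have := hi 3 (by omega) 1 (by omega) (by omega); omega
    omega
  have h1 : ∀ k, 4 ≤ k → k < N → g k + 1 = k := by
    intro k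
    induction k using Nat.strong_induction_on with
    | _ k ih =>
      intro k1 k2
      have h3 := h3 (by omega)
      have := h k (by omega) k2
      by_contra hne
      have a0 : g k ≠ 0 := fun e => by have := hi k k2 2 (by omega) (by omega); omega
      have a1 : g k ≠ 1 := fun e => by have := hi k k2 3 (by omega) (by omega); omega
      have a2 : g k ≠ 2 := fun e => by have := hi k k2 1 (by omega) (by omega); omega
      have e := ih (g k + 1) (by omega) (by omega) (by omega)
      have := hi (g k + 1) (by omega) k k2 (by omega)
      omega
  have hb0 := hb 0 (by omega)
  have a0 : g 0 ≠ 0 := fun e => by have := hi 0 (by omega) 2 (by omega) (by omega); omega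
  have a1 : g 0 ≠ 2 := fun e => by have := hi 0 (by omega) 1 (by omega) (by omega); omega
  refine ⟨h3, h1, ?_, ?_⟩
  · intro hN
    have h3 := h3 hN
    by_contra hne
    have a2 : g 0 ≠ 1 := fun e => by have := hi 0 (by omega) 3 (by omega) (by omega); omega
    have e := h1 (g 0 + 1) (by omega) (by omega)
    have := hi (g 0 + 1) (by omega) 0 (by omega) (by omega)
    omega
  · intro hN; omega

lemma label {m : ℕ} (q : Equiv.Perm (Fin (m+3)))
    (h : ∀ y, y ≠ 0 → y ≠ 1 → ∃ i, 1 ≤ i ∧ i < m + 2 ∧ (q ^ i) 1 = y) :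
    ∃ σ : Equiv.Perm (Fin (m+3)), σ 0 = 0 ∧ σ 1 = 1 ∧ ((σ * q * σ⁻¹) 1).val = m + 2 ∧
      ∀ k : Fin (m+3), 3 ≤ k.val → ((σ * q * σ⁻¹) k).val + 1 = k.val := by
  set f : Fin (m+3) → Fin (m+3) := fun k => if k = 0 then 0 else if k = 1 then 1 else
    (q ^ (m + 3 - k.val)) 1 with hf
  have hf2 : ∀ k : Fin (m+3), 2 ≤ k.val → f k = (q ^ (m + 3 - k.val)) 1 := by
    intro k hk
    have h0 : k ≠ 0 := by rintro rfl; simp at hk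
    have h1 : k ≠ 1 := by rintro rfl; simp at hk
    simp [hf, h0, h1]
  have hf0 : f 0 = 0 := by simp [hf]
  have hf1 : f 1 = 1 := by simp [hf]
  have hs : Function.Surjective f := by
    intro y
    by_cases y0 : y = 0
    · exact ⟨0, by rw [hf0, y0]⟩
    by_cases y1 : y = 1
    · exact ⟨1, by rw [hf1, y1]⟩
    obtain ⟨i, i1, i2, rfl⟩ := h y y0 y1
    refine ⟨⟨m + 3 - i, by omega⟩, ?_⟩
    rw [hf2 _ (by simp; omega)]
    congr 2
    simp; omega
  have hbij : Function.Bijective f := Finite.injective_iff_bijective.1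
    (Finite.injective_iff_surjective.2 hs)
  set e := Equiv.ofBijective f hbij with he
  have hef : ∀ k, e k = f k := fun k => rfl
  have key : ∀ k l, q (f k) = f l → (e.symm * q * e.symm⁻¹) k = l := by
    intro k l hkl
    have : (e.symm * q * e.symm⁻¹) k = e.symm (q (f k)) := rfl
    rw [this, hkl, ← hef, Equiv.symm_apply_apply]
  refine ⟨e.symm, ?_, ?_, ?_, ?_⟩
  · rw [Equiv.symm_apply_eq, hef, hf0]
  · rw [Equiv.symm_apply_eq, hef, hf1]
  · rw [key 1 ⟨m+2, by omega⟩]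
    rw [hf1, hf2 _ (by simp)]
    simp
  · intro k hk
    rw [key k ⟨k.val - 1, by omega⟩]
    · simp; omega
    · rw [hf2 k (by omega), hf2 _ (by simp; omega)]
      have : m + 3 - (k.val - 1) = (m + 3 - k.val) + 1 := by omega
      simp only [this, pow_succ', Equiv.Perm.mul_apply]

lemma ltfact {m : ℕ} {q0 q1 : Equiv.Perm (Fin (m+3))} (h : Ctr 0 1 q0 q1)
    (h0 : ∀ k : Fin (m+3), 3 ≤ k.val → (q0 k).val + 1 = k.val) (k : Fin (m+3)) (hk : 2 ≤ k.val) :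
    (q1 k).val < k.val := by
  by_contra hlt
  push Not at hlt
  let g : Fin (m+3) → Fin (m+3) := fun x => if x = k then q1 x else q0 x
  let K : ℕ → Fin (m+3) := fun t => g^[t] k
  have hK : ∀ t, k.val ≤ (K t).val := by
    intro t
    induction t with
    | zero => simp [K]
    | succ t ih =>
      have : K (t+1) = g (K t) := Function.iterate_succ_apply' g t k
      rw [this]
      by_cases e : K t = k
      · simp only [g, e, if_true]; exact hlt
      · have : (K t).val ≠ k.val := fun hh => e (Fin.ext hh)
        simp only [g, e, if_false]
        have := h0 (K t) (by omega)
        omega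
  refine factS h (fun t => decide (K t = k)) K (fun t => ?_) (fun t => ?_)
  · have := hK t
    have e0 : (0 : Fin (m+3)).val = 0 := rfl
    have e1 : (1 : Fin (m+3)).val = 1 := rfl
    constructor <;> (intro e; rw [e] at this; omega)
  · have : K (t+1) = g (K t) := Function.iterate_succ_apply' g t k
    rw [this]
    by_cases e : K t = k <;> simp [g, qq, e]

lemma hit {n : ℕ} {z o : Fin (n+1)} {q0 q1 : Equiv.Perm (Fin (n+1))} (h : Ctr z o q0 q1) (y : Fin (n+1)) :
    ∃ t : ℕ, (q0 ^ t) y = z ∨ (q0 ^ t) y = o := by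
  by_contra hh
  push Not at hh
  refine factS h (fun _ => false) (fun t => (q0 ^ t) y) hh (fun t => ?_)
  simp [qq, pow_succ']

lemma swap_big {m : ℕ} (x : Fin (m+3)) (h : 2 ≤ x.val) : Equiv.swap (0 : Fin (m+3)) 1 x = x :=
  Equiv.swap_apply_of_ne_of_ne (by rintro rfl; simp at h) (by rintro rfl; simp at h)

lemma rot_val {m : ℕ} {x y : Fin (m+3)} (h : x.val + 1 = y.val) : rot (m+2) x = y := by
  have : x + 1 = y := by
    apply Fin.ext
    rw [Fin.val_add_one_of_lt' (by omega)]
    exact h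
  exact this

lemma rot_last {m : ℕ} {x : Fin (m+3)} (h : x.val = m+2) : rot (m+2) x = 0 := by
  have : x = Fin.last (m+2) := Fin.ext h
  rw [this]
  exact Fin.last_add_one (m+2)

lemma cyc1 {m : ℕ} {q : Equiv.Perm (Fin (m+3))} (h0 : q 0 = 0)
    (h : ∀ y, ∃ t : ℕ, (q ^ t) y = 0 ∨ (q ^ t) y = 1) :
    ∀ y, y ≠ 0 → y ≠ 1 → ∃ i, 1 ≤ i ∧ i < m + 2 ∧ (q ^ i) 1 = y := by
  have hp : ∀ t : ℕ, (q ^ t) 0 = 0 := fun t => by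
    induction t with
    | zero => rfl
    | succ t ih => rw [pow_succ', Equiv.Perm.mul_apply, ih, h0]
  have hsc : ∀ y, y ≠ 0 → q.SameCycle 1 y := by
    intro y hy
    obtain ⟨t, ht | ht⟩ := h y
    · exact absurd ((q ^ t).injective (ht.trans (hp t).symm)) hy
    · exact (show q.SameCycle y 1 from ⟨t, by exact_mod_cast ht⟩).symm
  have hcyc : q.IsCycleOn ((Finset.univ.erase 0 : Finset (Fin (m+3))) : Set (Fin (m+3))) := by
    refine ⟨⟨?_, q.injective.injOn, ?_⟩, ?_⟩
    · intro x hx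
      simp only [Finset.coe_erase, Finset.coe_univ, Set.mem_sdiff, Set.mem_univ, true_and,
        Set.mem_singleton_iff] at *
      intro e; exact hx (q.injective (e.trans h0.symm))
    · intro x hx
      simp only [Finset.coe_erase, Finset.coe_univ, Set.mem_sdiff, Set.mem_univ, true_and,
        Set.mem_singleton_iff] at *
      refine ⟨q.symm x, ?_, by simp⟩
      simp only [Set.mem_sdiff, Set.mem_univ, true_and, Set.mem_singleton_iff]
      intro e
      rw [Equiv.symm_apply_eq, h0] at e
      exact hx e
    · intro x hx y hy
      simp only [Finset.coe_erase, Finset.coe_univ, Set.mem_sdiff, Set.mem_univ, true_and,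
        Set.mem_singleton_iff] at *
      exact (hsc x hx).symm.trans (hsc y hy)
  intro y y0 y1
  obtain ⟨i, hi, e⟩ := hcyc.exists_pow_eq (a := 1) (b := y) (by simp) (by simpa using y0)
  refine ⟨i, ?_, ?_, e⟩
  · rcases Nat.eq_zero_or_pos i with rfl | hh
    · exact absurd e.symm y1
    · exact hh
  · simpa using hi

lemma cyc2 {m : ℕ} {q : Equiv.Perm (Fin (m+3))} (h0 : q 0 = 1)
    (h : ∀ y, ∃ t : ℕ, (q ^ t) y = 0 ∨ (q ^ t) y = 1) :
    ∀ y, y ≠ 0 → y ≠ 1 → ∃ i, 1 ≤ i ∧ i < m + 2 ∧ (q ^ i) 1 = y := by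
  have h01 : q.SameCycle 0 1 := ⟨1, by simpa using h0⟩
  have hsc : ∀ y, q.SameCycle 0 y := by
    intro y
    obtain ⟨t, ht | ht⟩ := h y
    · exact (show q.SameCycle y 0 from ⟨t, by exact_mod_cast ht⟩).symm
    · exact h01.trans (show q.SameCycle y 1 from ⟨t, by exact_mod_cast ht⟩).symm
  have hcyc : q.IsCycleOn ((Finset.univ : Finset (Fin (m+3))) : Set (Fin (m+3))) := by
    refine ⟨?_, ?_⟩
    · simpa using Set.bijOn_univ.2 q.bijective
    · intro x _ y _
      exact (hsc x).symm.trans (hsc y)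
  intro y y0 y1
  obtain ⟨i, hi, e⟩ := hcyc.exists_pow_eq (a := 0) (b := y) (by simp) (by simp)
  have hi2 : 2 ≤ i := by
    match i, e with
    | 0, e => exact absurd e.symm y0
    | 1, e => exact absurd (by rw [← e]; simpa using h0) y1
    | i+2, e => omega
  refine ⟨i - 1, by omega, ?_, ?_⟩
  · simp at hi; omega
  · rw [← e, ← h0, ← Equiv.Perm.mul_apply, ← pow_succ, Nat.sub_add_cancel (by omega)]

lemma fin_cases3 {m : ℕ} (k : Fin (m+3)) : k = 0 ∨ k = 1 ∨ k = 2 ∨ 3 ≤ k.val := by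
  have e2 : (2 : Fin (m+3)).val = 2 := rfl
  have e1 : (1 : Fin (m+3)).val = 1 := rfl
  have e0 : (0 : Fin (m+3)).val = 0 := rfl
  by_cases h : 3 ≤ k.val
  · tauto
  · have : k.val = 0 ∨ k.val = 1 ∨ k.val = 2 := by omega
    rcases this with h | h | h
    · exact Or.inl (Fin.ext h)
    · exact Or.inr (Or.inl (Fin.ext h))
    · exact Or.inr (Or.inr (Or.inl (Fin.ext h)))

lemma eqR {m : ℕ} {q : Equiv.Perm (Fin (m+3))} (h : ∀ k : Fin (m+3), 1 ≤ k.val → (q k).val < k.val) :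
    q = (rot (m+2))⁻¹ := by
  obtain ⟨g, hg, hb, hi⟩ := natfun q
  obtain ⟨h1, h2⟩ := natA (by omega) hb hi (fun k k1 k2 => by
    have := h ⟨k, k2⟩ k1; rwa [hg] at this)
  refine eq_inv_of_mul_eq_one_right (Equiv.ext fun k => ?_)
  rw [Equiv.Perm.mul_apply, Equiv.Perm.one_apply]
  by_cases hk : k.val = 0
  · have : k = 0 := Fin.ext hk
    rw [this]
    apply rot_last
    rw [hg]; simp; omega
  · apply rot_val
    rw [hg]
    exact h1 _ (by omega) k.isLt

lemma core2 {m : ℕ} {q0 q1 : Equiv.Perm (Fin (m+3))} (h : Ctr 0 1 q0 q1) (h0 : q0 0 = 1)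
    (h1 : q1 1 = 0) : ∃ σ : Equiv.Perm (Fin (m+3)), σ 0 = 0 ∧ σ 1 = 1 ∧
      σ * q0 * σ⁻¹ = (Equiv.swap 0 1 * rot (m+2) * Equiv.swap 0 1)⁻¹ ∧
      σ * q1 * σ⁻¹ = (rot (m+2))⁻¹ := by
  obtain ⟨σ, s0, s1, a1, a2⟩ := label q0 (cyc2 h0 (hit h))
  refine ⟨σ, s0, s1, ?_⟩
  have hc := h.conj σ
  rw [s0, s1] at hc
  have i0 : σ⁻¹ 0 = 0 := by rw [Equiv.Perm.inv_eq_iff_eq, s0]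
  have i1 : σ⁻¹ 1 = 1 := by rw [Equiv.Perm.inv_eq_iff_eq, s1]
  have b0 : (σ * q0 * σ⁻¹) 0 = 1 := by simp only [Equiv.Perm.mul_apply, i0, h0, s1]
  have b1 : (σ * q1 * σ⁻¹) 1 = 0 := by simp only [Equiv.Perm.mul_apply, i1, h1, s0]
  generalize σ * q0 * σ⁻¹ = r0 at *
  generalize σ * q1 * σ⁻¹ = r1 at *
  have hlt := ltfact hc a2
  constructor
  · obtain ⟨g, hg, hb, hi⟩ := natfun r0
    have g0 : g 0 = 1 := by have := hg 0; rw [b0] at this; exact this.symm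
    have g1 : g 1 = m + 2 := by have := hg 1; rw [a1] at this; exact this.symm
    have g3 : ∀ k, 3 ≤ k → k < m + 3 → g k + 1 = k := fun k k1 k2 => by
      have := a2 ⟨k, k2⟩ k1; rwa [hg] at this
    have g2 : g 2 = 0 := by
      have := hb 2 (by omega)
      by_contra hne
      have c1 : g 2 ≠ 1 := fun e => by have := hi 2 (by omega) 0 (by omega) (by omega); omega
      have c2 : g 2 ≠ m+2 := fun e => by have := hi 2 (by omega) 1 (by omega) (by omega); omega
      have e := g3 (g 2 + 1) (by omega) (by omega)
      have := hi (g 2 + 1) (by omega) 2 (by omega) (by omega)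
      omega
    have b2 : r0 2 = 0 := Fin.ext ((hg 2).trans g2)
    refine eq_inv_of_mul_eq_one_right (Equiv.ext fun k => ?_)
    simp only [Equiv.Perm.mul_apply, Equiv.Perm.one_apply]
    rcases fin_cases3 k with rfl | rfl | rfl | hk
    · rw [b0, Equiv.swap_apply_right, rot_val (y := 1) (by simp), Equiv.swap_apply_right]
    · rw [swap_big (r0 1) (by omega), rot_last a1, Equiv.swap_apply_left]
    · rw [b2, Equiv.swap_apply_left, rot_val (y := 2) rfl, swap_big 2 (show 2 ≤ 2 from le_rfl)]
    · have := a2 k hk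
      rw [swap_big (r0 k) (by omega), rot_val this, swap_big k (by omega)]
  · refine eqR fun k hk => ?_
    by_cases e : 2 ≤ k.val
    · exact hlt k e
    · have : k = 1 := Fin.ext (by simp; omega)
      rw [this, b1]; simp


def Wr : ℕ → List Bool
  | 0 => []
  | r+1 => [false, true] ++ Wr r

lemma tau1 {A B C D : Prop} (h1 : B ↔ ¬ A) (h2 : D ↔ ¬ C) : (A ↔ C) ↔ (B ↔ D) := by
  rw [h1, h2, not_iff_not]

lemma residual_case {m : ℕ} {q0 q1 : Equiv.Perm (Fin (m+3))} (h : Ctr 0 1 q0 q1)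
    {g0 g1 : ℕ → ℕ} (hg0 : ∀ k : Fin (m+3), (q0 k).val = g0 k.val)
    (hg1 : ∀ k : Fin (m+3), (q1 k).val = g1 k.val)
    (a0 : g0 0 = 0) (a1 : g0 1 = m+2) (a2 : g0 2 = 1)
    (a3 : ∀ k, 3 ≤ k → k < m+3 → g0 k + 1 = k)
    (b1 : g1 1 = 2) (b2 : g1 2 = 0) (b3 : 0 < m → g1 3 = 1)
    (b4 : ∀ k, 4 ≤ k → k < m+3 → g1 k + 1 = k) (b0 : 0 < m → g1 0 = m + 2)
    (b0' : m = 0 → g1 0 = 1) : False := by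
  have v0 : (0 : Fin (m+3)).val = 0 := rfl
  have v1 : (1 : Fin (m+3)).val = 1 := rfl
  have v2 : (2 : Fin (m+3)).val = 2 := rfl
  rcases Nat.even_or_odd m with ⟨s, hs⟩ | ⟨s, hs⟩
  · have e1 : ∀ r, WW 0 1 q0 q1 (Wr (r+1)) =
        WW 0 1 q0 q1 [false, true] * WW 0 1 q0 q1 (Wr r) := fun r => wp_append _ _ _ _
    have step : ∀ r (i k j : Fin (m+3)), g1 (g0 i.val) = k.val → 1 ≤ WW 0 1 q0 q1 (Wr r) k j →
        1 ≤ WW 0 1 q0 q1 (Wr (r+1)) i j := by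
      intro r i k j hk hr
      rw [e1]
      refine mul_ge (WW_nn _ _ _ _ _) (WW_nn _ _ _ _ _) (k := k) ?_ hr
      have := WW_qw 0 1 q0 q1 [false, true] i
      have e : qw q0 q1 [false, true] i = k := by
        change q1 (q0 i) = k
        apply Fin.ext; rw [hg1, hg0, hk]
      rwa [e] at this
    have step' : ∀ r (k j : Fin (m+3)), g1 (g0 1) = k.val → 1 ≤ WW 0 1 q0 q1 (Wr r) k j →
        1 ≤ WW 0 1 q0 q1 (Wr (r+1)) 0 j := by
      intro r k j hk hr
      rw [e1]
      refine mul_ge (WW_nn _ _ _ _ _) (WW_nn _ _ _ _ _) (k := k) ?_ hr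
      have := WW_qw' 0 1 q0 q1 false [true]
      have e : qw q0 q1 [false, true] (ob 0 1 false) = k := by
        change q1 (q0 1) = k
        apply Fin.ext; rw [hg1, hg0, v1, hk]
      rw [e] at this
      exact this
    have E0 : ∀ i, 1 ≤ WW 0 1 q0 q1 (Wr 0) i i := fun i => by
      simp [Wr, WW, wp_nil]
    obtain ⟨r, c1, c2, c3⟩ : ∃ r, 1 ≤ WW 0 1 q0 q1 (Wr r) 0 0 ∧ 1 ≤ WW 0 1 q0 q1 (Wr r) 0 1 ∧
        1 ≤ WW 0 1 q0 q1 (Wr r) 1 0 := by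
      by_cases hm : m = 0
      · subst hm
        refine ⟨1, step' 0 0 0 ?_ (E0 0), step 0 0 1 1 ?_ (E0 1), step 0 1 0 0 ?_ (E0 0)⟩
        · rw [a1, v0]; exact b2
        · rw [v0, a0, v1]; exact b0' rfl
        · rw [v1, a1, v0]; exact b2
      · have b3 := b3 (by omega)
        have b0 := b0 (by omega)
        have ch : ∀ r, ∀ i : Fin (m+3), (i.val = 2*r+3 → 1 ≤ WW 0 1 q0 q1 (Wr (r+1)) i 0) ∧
            (i.val = 2*r+4 → 1 ≤ WW 0 1 q0 q1 (Wr (r+1)) i 1) := by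
          intro r
          induction r with
          | zero =>
            refine fun i => ⟨fun hi => step 0 i 0 0 ?_ (E0 0), fun hi => step 0 i 1 1 ?_ (E0 1)⟩
            · have := a3 i.val (by omega) i.isLt
              rw [show g0 i.val = 2 by omega, b2, v0]
            · have := a3 i.val (by omega) i.isLt
              rw [show g0 i.val = 3 by omega, b3, v1]
          | succ r ih =>
            refine fun i => ⟨fun hi => step (r+1) i ⟨i.val - 2, by omega⟩ 0 ?_ ((ih _).1 ?_),
              fun hi => step (r+1) i ⟨i.val - 2, by omega⟩ 1 ?_ ((ih _).2 ?_)⟩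
            · have c := a3 i.val (by omega) i.isLt
              have := b4 (g0 i.val) (by omega) (by omega)
              simp only; omega
            · simp only; omega
            · have c := a3 i.val (by omega) i.isLt
              have := b4 (g0 i.val) (by omega) (by omega)
              simp only; omega
            · simp only; omega
        have d := b4 (m+2) (by omega) (by omega)
        refine ⟨s+1, ?_⟩
        obtain ⟨s, rfl⟩ : ∃ u, s = u + 1 := ⟨s - 1, by omega⟩
        refine ⟨step' _ ⟨m+1, by omega⟩ 0 ?_ ((ch s _).1 ?_),
          step _ 0 ⟨m+2, by omega⟩ 1 ?_ ((ch s _).2 ?_),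
          step _ 1 ⟨m+1, by omega⟩ 0 ?_ ((ch s _).1 ?_)⟩
        · rw [a1]; simp only; omega
        · simp only; omega
        · rw [v0, a0, b0]
        · simp only; omega
        · rw [v1, a1]; simp only; omega
        · simp only; omega
    have P : ∀ r, Pth 0 1 q0 q1 (Wr r) 2 2 := by
      intro r
      induction r with
      | zero => rfl
      | succ r ih =>
        refine Pth.append (l := 2) ⟨?_, ?_, ?_⟩ ih
        · intro e; have := congrArg Fin.val e; change 2 = 1 at this; omega
        · have : q0 2 = 1 := by apply Fin.ext; rw [hg0, v2, a2, v1]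
          change q0 2 ≠ 0
          rw [this]; intro e; have := congrArg Fin.val e; rw [v1, v0] at this; omega
        · change q1 (q0 2) = 2
          apply Fin.ext; rw [hg1, hg0, v2, a2, b1]
    have e2 : WW 0 1 q0 q1 (Wr r ++ Wr r) = WW 0 1 q0 q1 (Wr r) * WW 0 1 q0 q1 (Wr r) :=
      wp_append _ _ _ _
    have nn := WW_nn 0 1 q0 q1 (Wr r)
    refine growth (Cm_nn _ _ _) (Cm_nn _ _ _) h (Wr r ++ Wr r) 2 0 1 ?_ ?_ ?_
      ((P r).append (P r)).col ?_ ?_ ?_ ?_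
    · intro e; have := congrArg Fin.val e; omega
    · intro e; have := congrArg Fin.val e; omega
    · intro e; have := congrArg Fin.val e; omega
    · change 1 ≤ WW _ _ _ _ _ _ _
      rw [e2]; exact mul_ge nn nn c1 c1
    · change 1 ≤ WW _ _ _ _ _ _ _
      rw [e2]; exact mul_ge nn nn c1 c2
    · change 1 ≤ WW _ _ _ _ _ _ _
      rw [e2]; exact mul_ge nn nn c3 c1
    · change 1 ≤ WW _ _ _ _ _ _ _
      rw [e2]; exact mul_ge nn nn c3 c2
  · let P : ℕ → Prop := fun k => k = 0 ∨ k = 1 ∨ (4 ≤ k ∧ k % 2 = 0)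
    have b3 := b3 (by omega)
    have b0 := b0 (by omega)
    have key : ∀ k, k < m+3 → (P (g1 k) ↔ ¬ P k) := by
      intro k hk
      simp only [P]
      by_cases k4 : 4 ≤ k
      · have := b4 k k4 hk
        omega
      · have : k = 0 ∨ k = 1 ∨ k = 2 ∨ k = 3 := by omega
        rcases this with rfl | rfl | rfl | rfl
        · rw [b0]; omega
        · rw [b1]; omega
        · rw [b2]; omega
        · rw [b3]; omega
    have P0 : P 0 := Or.inl rfl
    have P1 : P 1 := Or.inr (Or.inl rfl)
    have P2 : ¬ P 2 := by simp only [P]; omega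
    refine IJ (Cm_nn _ _ _) (Cm_nn _ _ _) h (fun _ => true) (fun t i => P i.val ↔ t % 2 = 0) ?_ ?_ ?_
    · intro t i j hij
      have hp : P j.val ↔ ¬ P i.val := by
        rw [Lt_eq] at hij
        simp only [Cm, Matrix.of_apply, qq, ob, cond_true, cond_false, Bool.not_true] at hij
        by_cases e : q1 i = j
        · rw [← e, hg1]; exact key _ i.isLt
        · have e2 : i = 1 ∧ q1 0 = j := by
            by_contra hh; simp [e, hh] at hij
          rw [← e2.2, e2.1, hg1, v0, v1, key 0 (by omega)]
          exact ⟨fun hh => absurd P0 hh, fun hh => absurd P1 hh⟩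
      have ht : (t+1) % 2 = 0 ↔ ¬ (t % 2 = 0) := by omega
      exact tau1 hp ht
    · intro t
      by_cases ht : t % 2 = 0
      · exact ⟨0, iff_of_true P0 ht⟩
      · exact ⟨2, iff_of_false P2 ht⟩
    · intro t
      by_cases ht : t % 2 = 0
      · exact ⟨2, fun hh => P2 (hh.2 ht)⟩
      · exact ⟨0, fun hh => ht (hh.1 P0)⟩

lemma core1 {m : ℕ} {q0 q1 : Equiv.Perm (Fin (m+3))} (h : Ctr 0 1 q0 q1) (h0 : q0 0 = 0) :
    ∃ σ : Equiv.Perm (Fin (m+3)), σ 0 = 0 ∧ σ 1 = 1 ∧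
      σ * q0 * σ⁻¹ = (Equiv.swap 0 1 * rot (m+2))⁻¹ ∧
      (σ * q1 * σ⁻¹ = (rot (m+2))⁻¹ ∨ σ * q1 * σ⁻¹ = (rot (m+2) * Equiv.swap 0 1)⁻¹) := by
  obtain ⟨σ, s0, s1, a1, a2⟩ := label q0 (cyc1 h0 (hit h))
  refine ⟨σ, s0, s1, ?_⟩
  have hc := h.conj σ
  rw [s0, s1] at hc
  have i0 : σ⁻¹ 0 = 0 := by rw [Equiv.Perm.inv_eq_iff_eq, s0]
  have b0 : (σ * q0 * σ⁻¹) 0 = 0 := by simp only [Equiv.Perm.mul_apply, i0, h0, s0]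
  generalize σ * q0 * σ⁻¹ = r0 at *
  generalize σ * q1 * σ⁻¹ = r1 at *
  have hlt := ltfact hc a2
  have v0 : (0 : Fin (m+3)).val = 0 := rfl
  have v1 : (1 : Fin (m+3)).val = 1 := rfl
  have v2 : (2 : Fin (m+3)).val = 2 := rfl
  obtain ⟨g, hg, hb, hi⟩ := natfun r0
  have g0 : g 0 = 0 := by have := hg 0; rw [b0] at this; exact this.symm
  have g1 : g 1 = m + 2 := by have := hg 1; rw [a1] at this; exact this.symm
  have g3 : ∀ k, 3 ≤ k → k < m + 3 → g k + 1 = k := fun k k1 k2 => by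
    have := a2 ⟨k, k2⟩ k1; rwa [hg] at this
  have g2 : g 2 = 1 := by
    have := hb 2 (by omega)
    by_contra hne
    have c1 : g 2 ≠ 0 := fun e => by have := hi 2 (by omega) 0 (by omega) (by omega); omega
    have c2 : g 2 ≠ m+2 := fun e => by have := hi 2 (by omega) 1 (by omega) (by omega); omega
    have e := g3 (g 2 + 1) (by omega) (by omega)
    have := hi (g 2 + 1) (by omega) 2 (by omega) (by omega)
    omega
  have b2 : r0 2 = 1 := Fin.ext ((hg 2).trans g2)
  constructor
  · refine eq_inv_of_mul_eq_one_right (Equiv.ext fun k => ?_)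
    simp only [Equiv.Perm.mul_apply, Equiv.Perm.one_apply]
    rcases fin_cases3 k with rfl | rfl | rfl | hk
    · rw [b0, rot_val (y := 1) rfl, Equiv.swap_apply_right]
    · rw [rot_last a1, Equiv.swap_apply_left]
    · rw [b2, rot_val (y := 2) rfl, swap_big 2 (show 2 ≤ 2 from le_rfl)]
    · have := a2 k hk
      rw [rot_val this, swap_big k (by omega)]
  obtain ⟨f, hf, fb, fi⟩ := natfun r1
  have flt : ∀ k, 2 ≤ k → k < m+3 → f k < k := fun k k1 k2 => by
    have := hlt ⟨k, k2⟩ k1; rwa [hf] at this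
  by_cases f1 : f 1 = 0
  · left
    refine eqR fun k hk => ?_
    by_cases e : 2 ≤ k.val
    · exact hlt k e
    · rw [hf, show k.val = 1 by omega]; omega
  by_cases f1' : f 1 = 1
  · right
    obtain ⟨f2, f3, f0⟩ := natB (by omega) fb fi flt f1'
    have c0 : (r1 0).val = m+2 := by rw [hf, v0]; omega
    have c1 : r1 1 = 1 := by apply Fin.ext; rw [hf, v1, f1']
    have c2 : r1 2 = 0 := by apply Fin.ext; rw [hf, v2, f2, v0]
    refine eq_inv_of_mul_eq_one_right (Equiv.ext fun k => ?_)
    simp only [Equiv.Perm.mul_apply, Equiv.Perm.one_apply]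
    rcases fin_cases3 k with rfl | rfl | rfl | hk
    · rw [swap_big (r1 0) (by omega), rot_last c0]
    · rw [c1, Equiv.swap_apply_right, rot_val (y := 1) rfl]
    · rw [c2, Equiv.swap_apply_left, rot_val (y := 2) rfl]
    · have := f3 k.val hk k.isLt
      rw [← hf] at this
      rw [swap_big (r1 k) (by omega), rot_val this]
  exfalso
  have desc : ∀ d : ℕ, ∀ x y : Fin (m+3), 1 ≤ y.val → x.val = y.val + d →
      Reach 0 1 r0 r1 x y := by
    intro d
    induction d with
    | zero => intro x y _ e; rw [Fin.ext (a := x) (b := y) e]; exact Reach.refl _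
    | succ d ih =>
      intro x y hy e
      refine (Reach.s0 (fun e' => ?_)).trans (ih (r0 x) y hy ?_)
      · rw [e', v1] at e; omega
      · rw [hg]
        by_cases hx : 3 ≤ x.val
        · have := g3 x.val hx x.isLt; omega
        · rw [show x.val = 2 by omega, g2]; omega
  have f1b := fb 1 (by omega)
  have fz : ∀ k, 2 ≤ k → k ≤ f 1 → f k = 0 := by
    intro k k2 k1
    by_contra hne
    have r1j : Reach 0 1 r0 r1 1 ⟨k, by omega⟩ := by
      refine (Reach.s1 (fun e => ?_)).trans (desc (f 1 - k) (r1 1) ⟨k, by omega⟩ ?_ ?_)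
      · have := congrArg Fin.val e; omega
      · simp only; omega
      · rw [hf, v1]; simp only; omega
    have all : ∀ x : Fin (m+3), 1 ≤ x.val → Reach 0 1 r0 r1 x ⟨k, by omega⟩ := fun x hx =>
      (desc (x.val - 1) x 1 (by omega) (by omega)).trans r1j
    refine factD (k := ⟨k, by omega⟩) ?_ hc ?_ ?_ (all _ ?_) (all _ ?_)
    · intro e; have := congrArg Fin.val e; omega
    · intro e; have := congrArg Fin.val e; simp only [v0] at this; omega
    · intro e; have := congrArg Fin.val e; simp only [v1] at this; omega
    · rw [hg]; simp only
      by_cases hx : 3 ≤ k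
      · have := g3 k hx (by omega); omega
      · rw [show k = 2 by omega, g2]
    · rw [hf]; simp only; omega
  have f12 : f 1 = 2 := by
    by_contra hne
    have x2 := fz 2 le_rfl (by omega)
    have x3 := fz 3 (by omega) (by omega)
    have := fi 2 (by omega) 3 (by omega) (by omega)
    omega
  have f2 := fz 2 le_rfl (by omega)
  obtain ⟨n1, n2, n3, n4⟩ := natC (by omega) fb fi flt f12 f2
  exact residual_case hc hg hf g0 g1 g2 g3 f12 f2 (fun _ => n1 (by omega)) n2
    (fun _ => by have := n3 (by omega); omega) (fun _ => n4 (by omega))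

lemma n1case (p : Equiv.Perm (Fin 2)) : p = 1 ∨ p = Equiv.swap 0 1 := by
  revert p; decide

theorem stmt4 (n : ℕ) (hn : 1 ≤ n) (P0 P1 : MatZ n)
    (hP0 : IsPermMat P0) (hP1 : IsPermMat P1)
    (hC : Contractive (Nmat n * P0) (Lmat n * P1)) :
    ∃ σ : Equiv.Perm (Fin (n + 1)), σ 0 = 0 ∧ σ 1 = 1 ∧
      (InThree n (permMat σ * (Nmat n * P0) * permMat σ⁻¹)
                 (permMat σ * (Lmat n * P1) * permMat σ⁻¹) ∨
       InThree n (Fmat n * (permMat σ * (Lmat n * P1) * permMat σ⁻¹) * Fmat n)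
                 (Fmat n * (permMat σ * (Nmat n * P0) * permMat σ⁻¹) * Fmat n)) := by
  obtain ⟨p0, rfl⟩ := isPerm_eq hP0
  obtain ⟨p1, rfl⟩ := isPerm_eq hP1
  have E0 : Nmat n * permMat p0 = Cm 0 1 p0⁻¹ := by
    rw [Nmat_eq hn, Cm_mul_permMat, mul_one]
  have E1 : Lmat n * permMat p1 = Cm 1 0 p1⁻¹ := by
    rw [Lmat_eq hn, Cm_mul_permMat, mul_one]
  have M0 : Mon0 n = Cm 0 1 (Equiv.swap 0 1 * rot n)⁻¹ := by
    rw [Mon0, Nmat_eq hn, Fmat_eq, Rmat_eq, mul_assoc, permMat_permMat, Cm_mul_permMat, mul_one]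
  have M1 : Mon1 n = Cm 1 0 (rot n)⁻¹ := by
    rw [Mon1, Lmat_eq hn, Rmat_eq, Cm_mul_permMat, mul_one]
  have M0F : Mon0 n * Fmat n = Cm 0 1 (Equiv.swap 0 1 * rot n * Equiv.swap 0 1)⁻¹ := by
    rw [M0, Fmat_eq, Cm_mul_permMat, _root_.mul_inv_rev (Equiv.swap 0 1 * rot n)]
  have M1F : Mon1 n * Fmat n = Cm 1 0 (rot n * Equiv.swap 0 1)⁻¹ := by
    rw [M1, Fmat_eq, Cm_mul_permMat, _root_.mul_inv_rev (rot n)]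
  have FF : ∀ σ : Equiv.Perm (Fin (n+1)), ∀ z o q, Fmat n * Cm z o q * Fmat n =
      Cm (Equiv.swap 0 1 z) (Equiv.swap 0 1 o) (Equiv.swap 0 1 * q * (Equiv.swap 0 1)⁻¹) := by
    intro σ z o q
    rw [← conj_Cm, Equiv.swap_inv, Fmat_eq]
  rw [E0, E1] at hC
  rw [E0, E1]
  clear E0 E1 hP0 hP1
  simp only [InThree, M0F, M1F, conj_Cm, Prod.mk.injEq]
  rw [M0, M1]
  have hctr : Ctr 0 1 p0⁻¹ p1⁻¹ := hC
  generalize p0⁻¹ = q0 at *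
  generalize p1⁻¹ = q1 at *
  obtain ⟨m, rfl⟩ : ∃ m, n = m + 1 := ⟨n - 1, by omega⟩
  rcases m with _ | m
  · refine ⟨1, rfl, rfl, ?_⟩
    have t1 : (Equiv.swap 0 1 * rot 1)⁻¹ = 1 := by decide
    have t2 : (rot 1)⁻¹ = Equiv.swap 0 1 := by decide
    have t3 : (rot 1 * Equiv.swap 0 1)⁻¹ = 1 := by decide
    have t4 : (Equiv.swap 0 1 * rot 1 * Equiv.swap 0 1)⁻¹ = Equiv.swap 0 1 := by decide
    have t5 : Equiv.swap (0 : Fin 2) 1 * 1 * (Equiv.swap 0 1)⁻¹ = 1 := by decide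
    have t6 : Equiv.swap (0 : Fin 2) 1 * Equiv.swap 0 1 * (Equiv.swap 0 1)⁻¹ = Equiv.swap 0 1 := by
      decide
    have t7 : (1 : Equiv.Perm (Fin 2)) 0 = 0 := rfl
    have t8 : (1 : Equiv.Perm (Fin 2)) 1 = 1 := rfl
    simp only [zero_add, Nat.reduceAdd, FF 1, t1, t2, t3, t4, inv_one, one_mul, mul_one,
      Equiv.Perm.one_apply, Equiv.swap_apply_left, Equiv.swap_apply_right] at *
    rcases n1case q0 with rfl | rfl <;> rcases n1case q1 with rfl | rfl
    · exact Or.inl (Or.inr (Or.inl ⟨rfl, rfl⟩))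
    · exact Or.inl (Or.inl ⟨rfl, rfl⟩)
    · refine Or.inr (Or.inl ⟨?_, ?_⟩)
      · exact congrArg (Cm 0 1) t5
      · exact congrArg (Cm 1 0) t6
    · exact Or.inl (Or.inr (Or.inr ⟨rfl, rfl⟩))
  have h01 : (0 : Fin (m+3)) ≠ 1 := fun e => by have := congrArg Fin.val e; change 0 = 1 at this; omega
  rcases core0 h01 hctr with c | c | ⟨c, d⟩
  · obtain ⟨σ, s0, s1, x, y⟩ := core1 hctr c
    refine ⟨σ, s0, s1, Or.inl ?_⟩
    rw [s0, s1, x]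
    rcases y with y | y
    · rw [y]; exact Or.inl ⟨rfl, rfl⟩
    · rw [y]; exact Or.inr (Or.inl ⟨rfl, rfl⟩)
  · have hs := hctr.swap.conj (Equiv.swap 0 1)
    rw [Equiv.swap_apply_left, Equiv.swap_apply_right, Equiv.swap_inv] at hs
    obtain ⟨σ, s0, s1, x, y⟩ := core1 hs (by
      simp only [Equiv.Perm.mul_apply, Equiv.swap_apply_left, c, Equiv.swap_apply_right])
    have hcomm : σ * Equiv.swap 0 1 = Equiv.swap 0 1 * σ := by
      rw [Equiv.mul_swap_eq_swap_mul, s0, s1]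
    have hcomm' : Equiv.swap 0 1 * σ⁻¹ = σ⁻¹ * Equiv.swap 0 1 := by
      rw [eq_inv_mul_iff_mul_eq, ← mul_assoc, hcomm, mul_assoc, mul_inv_cancel, mul_one]
    have key : ∀ q, Equiv.swap 0 1 * (σ * q * σ⁻¹) * (Equiv.swap 0 1)⁻¹ =
        σ * (Equiv.swap 0 1 * q * Equiv.swap 0 1) * σ⁻¹ := by
      intro q
      calc Equiv.swap 0 1 * (σ * q * σ⁻¹) * (Equiv.swap 0 1)⁻¹
          = (Equiv.swap 0 1 * σ) * q * (σ⁻¹ * Equiv.swap 0 1) := by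
            rw [Equiv.swap_inv]; simp only [mul_assoc]
        _ = (σ * Equiv.swap 0 1) * q * (Equiv.swap 0 1 * σ⁻¹) := by rw [hcomm, hcomm']
        _ = _ := by simp only [mul_assoc]
    refine ⟨σ, s0, s1, Or.inr ?_⟩
    rw [FF σ, FF σ, s0, s1, Equiv.swap_apply_left, Equiv.swap_apply_right, key, key, x]
    rcases y with y | y
    · rw [y]; exact Or.inl ⟨rfl, rfl⟩
    · rw [y]; exact Or.inr (Or.inl ⟨rfl, rfl⟩)
  · obtain ⟨σ, s0, s1, x, y⟩ := core2 hctr c d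
    refine ⟨σ, s0, s1, Or.inl ?_⟩
    rw [s0, s1, x, y]
    exact Or.inr (Or.inr ⟨rfl, rfl⟩)
end

section
/- Let C, D ∈ Σ be such that (i) there exists an index i with C e_i = e_i and D e_i = e_i, and (ii) the interiors of C[Δ] and D[Δ] relative to Δ do not intersect. Then the monoid generated by C and D contains a matrix whose spectral radius is strictly greater than 1. -/
open Matrix

namespace S11

lemma trace_le {n : ℕ} (E : MatZ n)
    (h : ∀ μ : ℂ, μ ∈ spectrum ℂ (E.map ((↑) : ℤ → ℂ)) → ‖μ‖ ≤ 1) :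
    E.trace ≤ n + 1 := by
  set A : Matrix (Fin (n+1)) (Fin (n+1)) ℂ := E.map ((↑) : ℤ → ℂ) with hA
  have h1 : A.trace = A.charpoly.roots.sum := Matrix.trace_eq_sum_roots_charpoly A
  have h2 : ‖A.charpoly.roots.sum‖ ≤ (A.charpoly.roots.map (fun x => ‖x‖)).sum :=
    norm_multiset_sum_le _
  have h3 : (A.charpoly.roots.map (fun x => ‖x‖)).sum ≤ A.charpoly.roots.card • (1:ℝ) := by
    have := Multiset.sum_le_card_nsmul (A.charpoly.roots.map (fun x => ‖x‖)) 1 (by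
      intro x hx
      obtain ⟨μ, hμ, rfl⟩ := Multiset.mem_map.1 hx
      apply h
      rw [Matrix.mem_spectrum_iff_isRoot_charpoly]
      exact (Polynomial.mem_roots'.1 hμ).2)
    simpa using this
  have h4 : A.charpoly.roots.card ≤ n + 1 := by
    have := Polynomial.card_roots' A.charpoly
    rwa [Matrix.charpoly_natDegree_eq_dim, Fintype.card_fin] at this
  have h5 : A.trace = ((E.trace : ℤ) : ℂ) := by
    simp [Matrix.trace, hA]
  have h6 : ‖((E.trace : ℤ) : ℂ)‖ ≤ (n + 1 : ℝ) := by
    rw [← h5, h1]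
    refine h2.trans (h3.trans ?_)
    simp only [nsmul_eq_mul, mul_one]
    exact_mod_cast h4
  rw [Complex.norm_intCast] at h6
  have h7 := (le_abs_self _).trans h6
  exact_mod_cast h7

lemma exists_pow_mod {n : ℕ} (C : MatZ n) (hC : IsUnit C.det) (m : ℕ) [NeZero m] :
    ∃ k : ℕ, ∀ a b, (m : ℤ) ∣ (C ^ (k+1)) a b - (1 : MatZ n) a b := by
  have hu : IsUnit C := (Matrix.isUnit_iff_isUnit_det C).2 hC
  let φ := (Int.castRingHom (ZMod m)).mapMatrix (m := Fin (n+1))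
  obtain ⟨u, hu'⟩ := hu.map φ
  have ho : 0 < orderOf u := orderOf_pos u
  refine ⟨orderOf u - 1, fun a b => ?_⟩
  rw [Nat.sub_add_cancel ho]
  have h1 : φ (C ^ orderOf u) = φ 1 := by
    rw [map_pow, ← hu', map_one, ← Units.val_pow_eq_pow_val, pow_orderOf_eq_one, Units.val_one]
  have h2 := congrFun (congrFun h1 a) b
  rw [← ZMod.intCast_zmod_eq_zero_iff_dvd]
  simp only [φ, RingHom.mapMatrix_apply, Matrix.map_apply, Int.coe_castRingHom] at h2
  push_cast
  rw [h2, sub_self]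

noncomputable def invR {n : ℕ} (C : MatZ n) : Matrix (Fin (n + 1)) (Fin (n + 1)) ℝ := toR C⁻¹

lemma toR_mul {n : ℕ} (A B : MatZ n) : toR (A * B) = toR A * toR B :=
  (Int.castRingHom ℝ).mapMatrix.map_mul A B

lemma toR_one {n : ℕ} : toR (1 : MatZ n) = 1 :=
  (Int.castRingHom ℝ).mapMatrix.map_one

lemma inv_mulVec {n : ℕ} {C : MatZ n} (hC : inSigma C) (x : Fin (n+1) → ℝ) :
    invR C *ᵥ (toR C *ᵥ x) = x := by
  rw [Matrix.mulVec_mulVec, invR, ← toR_mul, Matrix.nonsing_inv_mul _ hC.1, toR_one,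
    Matrix.one_mulVec]

lemma mulVec_inv {n : ℕ} {C : MatZ n} (hC : inSigma C) (x : Fin (n+1) → ℝ) :
    toR C *ᵥ (invR C *ᵥ x) = x := by
  rw [Matrix.mulVec_mulVec, invR, ← toR_mul, Matrix.mul_nonsing_inv _ hC.1, toR_one,
    Matrix.one_mulVec]

def cone {n : ℕ} (C : MatZ n) : Set (Fin (n+1) → ℝ) := {z | ∀ i, 0 < (invR C *ᵥ z) i}

lemma cone_open {n : ℕ} (C : MatZ n) : IsOpen (cone C) := by
  have : cone C = ⋂ i, {z | 0 < (invR C *ᵥ z) i} := by ext; simp [cone]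
  rw [this]
  refine isOpen_iInter_of_finite fun i => isOpen_lt continuous_const ?_
  exact (continuous_apply i).comp (Continuous.matrix_mulVec continuous_const continuous_id)

lemma cone_convex {n : ℕ} (C : MatZ n) : Convex ℝ (cone C) := by
  intro x hx y hy a b ha hb hab i
  simp only [Matrix.mulVec_add, Matrix.mulVec_smul, Pi.add_apply, Pi.smul_apply, smul_eq_mul]
  have h1 := hx i
  have h2 := hy i
  rcases ha.eq_or_lt with rfl | ha
  · have : b = 1 := by linarith
    subst this; simpa using h2
  · have := mul_pos ha h1
    have := mul_nonneg hb h2.le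
    linarith

lemma sum_pos' {n : ℕ} {C : MatZ n} (hC : inSigma C) {x : Fin (n+1) → ℝ}
    (hx : ∀ i, 0 ≤ x i) (hx0 : x ≠ 0) : 0 < ∑ i, (toR C *ᵥ x) i := by
  have hnn : ∀ i, 0 ≤ (toR C *ᵥ x) i := by
    intro i
    have : ∀ j, 0 ≤ toR C i j := fun j => by simpa [toR] using hC.2 i j
    simp only [Matrix.mulVec, dotProduct]
    exact Finset.sum_nonneg fun j _ => mul_nonneg (this j) (hx j)
  refine lt_of_le_of_ne (Finset.sum_nonneg fun i _ => hnn i) fun h => hx0 ?_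
  have h0 : toR C *ᵥ x = 0 := by
    ext i
    exact (Finset.sum_eq_zero_iff_of_nonneg (fun i _ => hnn i)).1 h.symm i (Finset.mem_univ i)
  rw [← inv_mulVec hC x, h0, Matrix.mulVec_zero]

lemma simg_sum {n : ℕ} {C : MatZ n} (hC : inSigma C) {z : Fin (n+1) → ℝ}
    (hz : z ∈ affineSpan ℝ (simg C)) : ∑ i, z i = 1 := by
  refine affineSpan_induction (p := fun z : Fin (n+1) → ℝ => ∑ i, z i = 1) hz ?_ ?_
  · intro z hz
    obtain ⟨x, hx, rfl⟩ := hz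
    have hx0 : x ≠ 0 := by
      rintro rfl
      have := hx.2
      simp at this
    have := sum_pos' hC hx.1 hx0
    simp only [projAct, Pi.smul_apply, smul_eq_mul, ← Finset.mul_sum]
    exact inv_mul_cancel₀ this.ne'
  · intro c u v w hu hv hw
    simp [Finset.sum_add_distrib, ← Finset.mul_sum, hu, hv, hw]

lemma mem_simg {n : ℕ} {C : MatZ n} (hC : inSigma C) {z : Fin (n+1) → ℝ}
    (hz : z ∈ cone C) (hs : ∑ i, z i = 1) : z ∈ simg C := by
  set u := invR C *ᵥ z with hu
  have hp : 0 < ∑ i, u i := Finset.sum_pos (fun i _ => hz i) Finset.univ_nonempty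
  refine ⟨(∑ i, u i)⁻¹ • u, ⟨fun i => ?_, ?_⟩, ?_⟩
  · exact mul_nonneg (inv_nonneg.2 hp.le) (hz i).le
  · simp only [Pi.smul_apply, smul_eq_mul, ← Finset.mul_sum]
    exact inv_mul_cancel₀ hp.ne'
  · have h1 : toR C *ᵥ u = z := mulVec_inv hC z
    simp only [projAct, Matrix.mulVec_smul, h1, Pi.smul_apply, smul_eq_mul, ← Finset.mul_sum, hs,
      mul_one, inv_inv]
    rw [smul_smul, mul_inv_cancel₀ hp.ne', one_smul]

lemma mem_int' {n : ℕ} {C : MatZ n} (hC : inSigma C) {z : Fin (n+1) → ℝ}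
    (hz : z ∈ cone C) :
    (∑ i, z i)⁻¹ • z ∈ intrinsicInterior ℝ (simg C) := by
  have hpos : 0 < ∑ i, z i := by
    have := sum_pos' hC (x := invR C *ᵥ z) (fun i => (hz i).le) (by
      intro h
      have := hz 0
      rw [h] at this
      simp at this)
    rwa [mulVec_inv hC] at this
  have hz' : (∑ i, z i)⁻¹ • z ∈ cone C := by
    intro i
    rw [Matrix.mulVec_smul]
    exact mul_pos (inv_pos.2 hpos) (hz i)
  have hs' : ∑ i, ((∑ i, z i)⁻¹ • z) i = 1 := by
    simp only [Pi.smul_apply, smul_eq_mul, ← Finset.mul_sum]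
    exact inv_mul_cancel₀ hpos.ne'
  generalize (∑ i, z i)⁻¹ • z = p at hz' hs'
  have hmem := mem_simg hC hz' hs'
  rw [mem_intrinsicInterior]
  refine ⟨⟨p, mem_affineSpan ℝ hmem⟩, ?_, rfl⟩
  rw [mem_interior]
  refine ⟨Subtype.val ⁻¹' cone C, ?_, (cone_open C).preimage continuous_subtype_val, hz'⟩
  rintro ⟨q, hq⟩ hq'
  exact mem_simg hC hq' (simg_sum hC hq)

lemma exists_functional {n : ℕ} {C D : MatZ n} (hC : inSigma C) (hD : inSigma D)
    (hdisj : Disjoint (intrinsicInterior ℝ (simg C)) (intrinsicInterior ℝ (simg D))) :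
    ∃ v : Fin (n+1) → ℝ, v ≠ 0 ∧ (∀ b, (v ᵥ* toR C) b ≤ 0) ∧ (∀ b, 0 ≤ (v ᵥ* toR D) b) := by
  have hd : Disjoint (cone C) (cone D) := by
    rw [Set.disjoint_left]
    intro z h1 h2
    exact Set.disjoint_left.1 hdisj (mem_int' hC h1) (mem_int' hD h2)
  obtain ⟨f, u, h1, h2⟩ := geometric_hahn_banach_open_open (cone_convex C) (cone_open C)
    (cone_convex D) (cone_open D) hd
  set v : Fin (n+1) → ℝ := fun i => f (Pi.single i 1) with hv
  have hf : ∀ z, f z = v ⬝ᵥ z := by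
    intro z
    have : z = ∑ i, z i • (Pi.single i 1 : Fin (n+1) → ℝ) := by
      ext j; simp [Finset.sum_apply, Pi.single_apply]
    conv_lhs => rw [this]
    simp [dotProduct, hv, map_sum, mul_comm]
  have key : ∀ A : MatZ n, inSigma A → ∀ (t : ℝ), 0 ≤ t → ∀ b,
      toR A *ᵥ (t • Pi.single b 1 + 1) ∈ cone A := by
    intro A hA t ht b i
    rw [inv_mulVec hA]
    by_cases hib : i = b
    · subst hib; simp; linarith
    · simp [hib]
  have val : ∀ A : MatZ n, ∀ (t : ℝ) b,
      f (toR A *ᵥ (t • Pi.single b 1 + 1)) = t * (v ᵥ* toR A) b + f (toR A *ᵥ 1) := by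
    intro A t b
    rw [hf, hf, Matrix.dotProduct_mulVec, Matrix.dotProduct_mulVec, dotProduct_add,
      dotProduct_smul, dotProduct_single]
    simp
  have k1 := fun t ht b => h1 _ (key C hC t ht b)
  have k2 := fun t ht b => h2 _ (key D hD t ht b)
  simp only [val] at k1 k2
  have c0 := k1 0 le_rfl 0
  have d0 := k2 0 le_rfl 0
  rw [zero_mul, zero_add] at c0 d0
  refine ⟨v, ?_, fun b => ?_, fun b => ?_⟩
  · intro h0
    rw [hf, h0, zero_dotProduct] at c0 d0
    linarith
  · by_contra! hb
    have := k1 ((u - f (toR C *ᵥ 1)) / (v ᵥ* toR C) b) (div_nonneg (by linarith) hb.le) b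
    rw [div_mul_cancel₀ _ hb.ne'] at this
    linarith
  · by_contra! hb
    have := k2 ((u - f (toR D *ᵥ 1)) / (v ᵥ* toR D) b)
      (div_nonneg_of_nonpos (by linarith) hb.le) b
    rw [div_mul_cancel₀ _ hb.ne] at this
    linarith

lemma vecMul_pow_nonneg {n : ℕ} {C : MatZ n} (hC : ∀ i j, 0 ≤ C i j) (v : Fin (n+1) → ℝ)
    (h : ∀ b, 0 ≤ (v ᵥ* toR C) b) (k : ℕ) : ∀ b, 0 ≤ (v ᵥ* toR (C ^ (k+1))) b := by
  induction k with
  | zero => simpa using h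
  | succ k ih =>
    intro b
    rw [pow_succ, toR_mul, ← Matrix.vecMul_vecMul]
    have : ∀ j, 0 ≤ toR C j b := fun j => by simpa [toR] using hC j b
    exact Finset.sum_nonneg (s := Finset.univ) (f := fun j => (v ᵥ* toR (C ^ (k+1))) j * toR C j b)
      fun j _ => mul_nonneg (ih j) (this j)

end S11

open S11 in
theorem stmt11 (n : ℕ) (hn : 1 ≤ n) (C D : MatZ n) (hC : inSigma C) (hD : inSigma D)
    (i : Fin (n + 1))
    (hCi : C *ᵥ Pi.single i 1 = Pi.single i 1)
    (hDi : D *ᵥ Pi.single i 1 = Pi.single i 1)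
    (hdisj : Disjoint (intrinsicInterior ℝ (simg C)) (intrinsicInterior ℝ (simg D))) :
    ∃ E : MatZ n,
      (∃ l : List (MatZ n), l ≠ [] ∧ (∀ X ∈ l, X = C ∨ X = D) ∧ E = l.prod) ∧
      ∃ μ : ℂ, μ ∈ spectrum ℂ (E.map ((↑) : ℤ → ℂ)) ∧ 1 < ‖μ‖ := by
  by_contra! H
  let M : Submonoid (MatZ n) := Submonoid.closure {C, D}
  have hCM : C ∈ M := Submonoid.subset_closure (by simp)
  have hDM : D ∈ M := Submonoid.subset_closure (by simp)
  have htr : ∀ X, (X = C ∨ X = D) → ∀ V ∈ M, (X * V).trace ≤ n + 1 := by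
    intro X hX V hV
    obtain ⟨l, hl, rfl⟩ := Submonoid.exists_list_of_mem_closure hV
    refine trace_le _ (H _ ⟨X :: l, by simp, ?_, by simp⟩)
    intro Y hY
    rcases List.mem_cons.1 hY with rfl | hY
    · exact hX
    · simpa using hl Y hY
  have hnn : ∀ V ∈ M, ∀ a b, 0 ≤ V a b := by
    intro V hV
    induction hV using Submonoid.closure_induction with
    | mem x hx =>
      rcases hx with rfl | rfl
      · exact hC.2
      · exact hD.2
    | one => intro a b; rw [Matrix.one_apply]; split_ifs <;> simp
    | mul x y _ _ hx hy =>
      intro a b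
      rw [Matrix.mul_apply]
      exact Finset.sum_nonneg fun j _ => mul_nonneg (hx a j) (hy j b)
  let R : Fin (n+1) → Fin (n+1) → Prop := fun a b => ∃ V ∈ M, 0 < V a b
  have mul_ge : ∀ V ∈ M, ∀ W ∈ M, ∀ a b c, V a b * W b c ≤ (V * W) a c := by
    intro V hV W hW a b c
    rw [Matrix.mul_apply]
    exact Finset.single_le_sum (f := fun j => V a j * W j c)
      (fun j _ => mul_nonneg (hnn V hV a j) (hnn W hW j c)) (Finset.mem_univ b)
  have Rrefl : ∀ a, R a a := fun a => ⟨1, M.one_mem, by simp⟩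
  have Rtrans : ∀ a b c, R a b → R b c → R a c := by
    rintro a b c ⟨V, hV, h1⟩ ⟨W, hW, h2⟩
    exact ⟨V * W, M.mul_mem hV hW, (mul_pos h1 h2).trans_le (mul_ge V hV W hW a b c)⟩
  have hblock : ∀ X, (X = C ∨ X = D) → inSigma X → ∃ k : ℕ, ∀ a c, R a c →
      (X ^ (k+1)) c a = (1 : MatZ n) c a := by
    intro X hX hXS
    have hXM : X ∈ M := by rcases hX with rfl | rfl <;> assumption
    obtain ⟨k, hk⟩ := exists_pow_mod X hXS.1 (n+2)
    refine ⟨k, ?_⟩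
    rintro a c ⟨V, hV, hpos⟩
    have hP : X ^ (k+1) ∈ M := M.pow_mem hXM _
    have h0 := hnn _ hP c a
    have h1 : (X ^ (k+1)) c a ≤ n + 1 := by
      have e1 := mul_ge _ hP V hV c a c
      have e2 : (X ^ (k+1) * V) c c ≤ (X ^ (k+1) * V).trace :=
        Finset.single_le_sum (f := fun j => (X ^ (k+1) * V) j j)
          (fun j _ => hnn _ (M.mul_mem hP hV) j j) (Finset.mem_univ c)
      have e3 := htr X hX (X ^ k * V) (M.mul_mem (M.pow_mem hXM _) hV)
      rw [← mul_assoc, ← pow_succ'] at e3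
      nlinarith
    have h2 := hk c a
    have h3 : (1 : MatZ n) c a = 0 ∨ (1 : MatZ n) c a = 1 := by
      rw [Matrix.one_apply]; split_ifs <;> simp
    have h4 := Int.eq_zero_of_abs_lt_dvd h2 (by
      rw [abs_lt]; push_cast; rcases h3 with h | h <;> rw [h] <;> constructor <;> linarith)
    linarith
  obtain ⟨v, hv0, hvC, hvD⟩ := exists_functional hC hD hdisj
  classical
  let h : Fin (n+1) → ℕ := fun a => (Finset.univ.filter fun c => R c a).card
  have hne : (Finset.univ.filter fun a => v a ≠ 0).Nonempty := by
    obtain ⟨a, ha⟩ := Function.ne_iff.1 hv0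
    exact ⟨a, by simpa using ha⟩
  obtain ⟨a, ha, hmin⟩ := Finset.exists_min_image _ h hne
  have ha0 : v a ≠ 0 := by simpa using ha
  have hback : ∀ c, R c a → v c ≠ 0 → R a c := by
    intro c hca hc
    have hle := hmin c (by simpa using hc)
    have hsub : (Finset.univ.filter fun d => R d c) ⊆ (Finset.univ.filter fun d => R d a) := by
      intro d hd
      simp only [Finset.mem_filter, Finset.mem_univ, true_and] at hd ⊢
      exact Rtrans _ _ _ hd hca
    have heq := Finset.eq_of_subset_of_card_le hsub hle
    have : a ∈ (Finset.univ.filter fun d => R d c) := by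
      rw [heq]; simpa using Rrefl a
    simpa using this
  have hval : ∀ X ∈ M, ∀ k : ℕ, (∀ a c, R a c → (X ^ (k+1)) c a = (1 : MatZ n) c a) →
      (v ᵥ* toR (X ^ (k+1))) a = v a := by
    intro X hX k hk
    have : ∀ c, v c * toR (X ^ (k+1)) c a = v c * (1 : Matrix _ _ ℝ) c a := by
      intro c
      by_cases hc : v c = 0
      · simp [hc]
      by_cases hR : R a c
      · have := hk a c hR
        simp only [toR, Matrix.map_apply, this, Matrix.one_apply]
        push_cast; rfl
      · have hnR : ¬ R c a := fun hh => hR (hback c hh hc)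
        have hP : X ^ (k+1) ∈ M := M.pow_mem hX _
        have hz : (X ^ (k+1)) c a = 0 := by
          refine le_antisymm ?_ (hnn _ hP c a)
          by_contra! hh
          exact hnR ⟨_, hP, hh⟩
        have hca : c ≠ a := by rintro rfl; exact hR (Rrefl _)
        simp [toR, hz, hca]
    calc (v ᵥ* toR (X ^ (k+1))) a = ∑ c, v c * toR (X ^ (k+1)) c a := rfl
      _ = ∑ c, v c * (1 : Matrix _ _ ℝ) c a := Finset.sum_congr rfl fun c _ => this c
      _ = (v ᵥ* (1 : Matrix _ _ ℝ)) a := rfl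
      _ = v a := by rw [Matrix.vecMul_one]
  obtain ⟨k, hk⟩ := hblock C (Or.inl rfl) hC
  obtain ⟨j, hj⟩ := hblock D (Or.inr rfl) hD
  have f1 := vecMul_pow_nonneg hC.2 (-v) (by
    intro b; rw [Matrix.neg_vecMul]; simpa using hvC b) k a
  rw [Matrix.neg_vecMul, Pi.neg_apply, hval C hCM k hk] at f1
  have f2 := vecMul_pow_nonneg hD.2 v hvD j a
  rw [hval D hDM j hj] at f2
  exact ha0 (by linarith)
end
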